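/- arXiv:2507.22509 — 3 statements merged into one kernel-verified Lean document; each statement's English description precedes it below -/
import Mathlib

section
/- Let t ≥ 3. There is a constant c > 0 such that for every function f : ℕ → ℕ with the property that every finite simple graph containing no subgraph isomorphic to the complete bipartite graph K_{t,t} and containing a path on n vertices contains an induced path on at least f(n) vertices, there are infinitely many integers n with f(n) ≤ c · log₂ log₂ n · log₂ log₂ log₂ n. -/
/-- A graph is `k`-degenerate if every nonempty (finite) set of vertices contains a vertex
with at most `k` neighbors inside the set. -/
def Degenerate {V : Type*} (k : ℕ) (G : SimpleGraph V) : Prop :=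
  ∀ S : Set V, S.Finite → S.Nonempty → ∃ v ∈ S, {u ∈ S | G.Adj v u}.ncard ≤ k

/-- `G` contains a (not necessarily induced) path on `n` vertices. -/
def HasPathOn {V : Type*} (G : SimpleGraph V) (n : ℕ) : Prop :=
  ∃ p : Fin n → V, Function.Injective p ∧
    ∀ (i : ℕ) (h : i + 1 < n), G.Adj (p ⟨i, Nat.lt_of_succ_lt h⟩) (p ⟨i + 1, h⟩)

/-- `G` contains an induced path on `n` vertices. -/
def HasInducedPathOn {V : Type*} (G : SimpleGraph V) (n : ℕ) : Prop :=
  ∃ p : Fin n → V, Function.Injective p ∧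
    ∀ i j : Fin n, G.Adj (p i) (p j) ↔ (i.val + 1 = j.val ∨ j.val + 1 = i.val)

/-- `G` contains the complete bipartite graph `K_{t,t}` as a (not necessarily induced)
subgraph. -/
def ContainsKtt {V : Type*} (G : SimpleGraph V) (t : ℕ) : Prop :=
  ∃ a b : Fin t → V, Function.Injective a ∧ Function.Injective b ∧
    (∀ i j, a i ≠ b j) ∧ (∀ i j, G.Adj (a i) (b j))

namespace KttPath

/-- Nominal depth of a wall at depth `i`. -/
def dip (m i : ℕ) : ℕ :=
  min i (∑ j ∈ Finset.range (m + 1), if 2 ^ j ∣ i then 2 ^ (j + 1) else 0)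

/-- Number of labelled edges in the wall that closes a hub of depth `i`. -/
def wallLen (m i : ℕ) : ℕ := 2 * dip m i + 1

/-- States of the levels of the tree: a hub, a position inside a wall, or the end of the word.
The list `st` contains the levels of the open hubs, deepest first; `bits` records whether each of
them (and the current hub) is a first or a second child. -/
inductive St : Type
  | hub (st : List ℕ) (bits : List Bool) : St
  | wall (u : ℕ) (st : List ℕ) (bits : List Bool) (j : ℕ) : St
  | done : St

/-- The state reached after a wall has been crossed completely. -/
def afterWall : List ℕ → List Bool → St
  | st, false :: bs => St.hub st (true :: bs)
  | u :: st, true :: bs => St.wall u st bs 1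
  | _, _ => St.done

/-- The successor of a state at level `p`. -/
def nextState (m p : ℕ) : St → St
  | St.hub st bits =>
      if st.length < 2 ^ m then St.hub (p :: st) (false :: bits) else St.wall p st bits 1
  | St.wall u st bits j =>
      if j < wallLen m st.length then St.wall u st bits (j + 1) else afterWall st bits
  | St.done => St.done

/-- The state of each level. -/
def state (m : ℕ) : ℕ → St
  | 0 => St.hub [] []
  | p + 1 => nextState m p (state m p)

/-- The number of hubs that are popped at position `j` of a wall at depth `i`. -/
def popped (m i j : ℕ) : ℕ := min j (2 * dip m i + 2 - j)

/-- The levels of the hubs that enclose a level with the given state. -/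
def encl (m : ℕ) : St → List ℕ
  | St.hub st _ => st
  | St.wall u st _ j => (u :: st).drop (popped m st.length j)
  | St.done => []

/-- The label of the tree edge leading to a level with the given state. -/
def label (m : ℕ) : St → Option ℕ
  | St.wall u st _ j => (u :: st)[min (j - 1) (2 * dip m st.length + 2 - j)]?
  | _ => none

/-- The depth of a state. -/
def depth : St → ℕ
  | St.hub st _ => st.length
  | St.wall _ st _ _ => st.length
  | St.done => 0

/-- The invariants satisfied by the state of level `p`. -/
def Valid (m p : ℕ) : St → Prop
  | St.hub st bits => bits.length = st.length ∧ st.length ≤ 2 ^ m ∧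
      ∀ q st', st = q :: st' → q < p ∧ state m q = St.hub st' bits.tail
  | St.wall u st bits j => u < p ∧ state m u = St.hub st bits ∧ 1 ≤ j ∧ j ≤ wallLen m st.length
  | St.done => True

theorem dip_le (m i : ℕ) : dip m i ≤ i := min_le_left _ _

theorem wallLen_pos (m i : ℕ) : 1 ≤ wallLen m i := by simp [wallLen]

theorem valid_state (m p : ℕ) : Valid m p (state m p) := by
  induction p using Nat.strong_induction_on with
  | _ p ih =>
    cases p with
    | zero => simp [state, Valid]
    | succ p =>
      have hp := ih p (Nat.lt_succ_self p)
      rw [state]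
      generalize hs : state m p = s at hp
      cases s with
      | done => trivial
      | hub st bits =>
        obtain ⟨h1, h2, h3⟩ := hp
        simp only [nextState]
        split_ifs with h
        · refine ⟨by simp [h1], by simpa using h, ?_⟩
          intro q st' hq
          simp only [List.cons.injEq] at hq
          obtain ⟨rfl, rfl⟩ := hq
          exact ⟨Nat.lt_succ_self _, hs⟩
        · exact ⟨Nat.lt_succ_self _, hs, le_rfl, wallLen_pos _ _⟩
      | wall u st bits j =>
        obtain ⟨h1, h2, h3, h4⟩ := hp
        simp only [nextState]
        split_ifs with h
        · exact ⟨by omega, h2, by omega, h⟩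
        · have hu := ih u (by omega)
          rw [h2] at hu
          obtain ⟨k1, k2, k3⟩ := hu
          match st, bits with
          | st, false :: bs =>
            refine ⟨by simpa using k1, k2, ?_⟩
            intro q st' hq
            obtain ⟨a, b⟩ := k3 q st' hq
            exact ⟨by omega, b⟩
          | u' :: st', true :: bs =>
            obtain ⟨a, b⟩ := k3 u' st' rfl
            exact ⟨by omega, b, le_rfl, wallLen_pos _ _⟩
          | [], true :: bs => trivial
          | [], [] => trivial
          | _ :: _, [] => trivial

/-- The hubs on the stack of a hub are hubs whose stacks are the corresponding suffixes. -/
theorem hub_of_append (m : ℕ) {l₁ : List ℕ} : ∀ {p q : ℕ} {l₂ : List ℕ} {bits : List Bool},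
    state m p = St.hub (l₁ ++ q :: l₂) bits → q < p ∧ ∃ bt, state m q = St.hub l₂ bt := by
  induction l₁ with
  | nil =>
    intro p q l₂ bits h
    have hv := valid_state m p
    rw [h] at hv
    obtain ⟨a, b⟩ := hv.2.2 q l₂ rfl
    exact ⟨a, _, b⟩
  | cons a l ih =>
    intro p q l₂ bits h
    have hv := valid_state m p
    rw [h] at hv
    obtain ⟨a', b⟩ := hv.2.2 a (l ++ q :: l₂) rfl
    obtain ⟨c, d⟩ := ih b
    exact ⟨by omega, d⟩

/-- All open hubs, including the owner of a wall. -/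
def openHubs : St → List ℕ
  | St.hub st _ => st
  | St.wall u st _ _ => u :: st
  | St.done => []

theorem hub_of_openHubs {m p q : ℕ} {l₁ l₂ : List ℕ}
    (h : openHubs (state m p) = l₁ ++ q :: l₂) : q < p ∧ ∃ bt, state m q = St.hub l₂ bt := by
  have hv := valid_state m p
  generalize hs : state m p = s at h hv
  cases s with
  | done => simp [openHubs] at h
  | hub st bits =>
    simp only [openHubs] at h
    subst h
    exact hub_of_append m hs
  | wall u st bits j =>
    simp only [openHubs] at h
    obtain ⟨h1, h2, -⟩ := hv
    cases l₁ with
    | nil =>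
      simp only [List.nil_append, List.cons.injEq] at h
      obtain ⟨rfl, rfl⟩ := h
      exact ⟨h1, _, h2⟩
    | cons a l =>
      simp only [List.cons_append, List.cons.injEq] at h
      obtain ⟨rfl, rfl⟩ := h
      obtain ⟨a, b⟩ := hub_of_append m h2
      exact ⟨by omega, b⟩

theorem encl_suffix (m : ℕ) (s : St) : encl m s <:+ openHubs s := by
  cases s with
  | hub st bits => exact List.suffix_rfl
  | wall u st bits j => exact List.drop_suffix _ _
  | done => exact List.suffix_rfl

theorem hub_of_encl {m p q : ℕ} {l₁ l₂ : List ℕ}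
    (h : encl m (state m p) = l₁ ++ q :: l₂) : q < p ∧ ∃ bt, state m q = St.hub l₂ bt := by
  obtain ⟨t, ht⟩ := encl_suffix m (state m p)
  rw [h, ← List.append_assoc] at ht
  exact hub_of_openHubs ht.symm

theorem lt_of_mem_encl {m p q : ℕ} (h : q ∈ encl m (state m p)) : q < p := by
  obtain ⟨l₁, l₂, h⟩ := List.append_of_mem h
  exact (hub_of_encl h).1

theorem encl_hub {m q : ℕ} {st : List ℕ} {bt : List Bool} (h : state m q = St.hub st bt) :
    encl m (state m q) = st := by rw [h]; rfl

/-- How the list of enclosing hubs changes along an edge of the tree. -/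
theorem edge_cases (m p : ℕ) (hd : state m (p + 1) ≠ St.done) :
    (label m (state m (p + 1)) = none ∧ encl m (state m (p + 1)) = encl m (state m p) ∧
      ∃ u st bits j, state m p = St.wall u st bits j) ∨
    (label m (state m (p + 1)) = none ∧ encl m (state m (p + 1)) = p :: encl m (state m p)) ∨
    (∃ q, label m (state m (p + 1)) = some q ∧ q < p ∧
      encl m (state m p) = q :: encl m (state m (p + 1)) ∧
      encl m (state m (p + 1)) = encl m (state m q)) ∨
    (∃ q, label m (state m (p + 1)) = some q ∧ q < p ∧
      encl m (state m (p + 1)) = q :: encl m (state m p) ∧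
      encl m (state m p) = encl m (state m q)) ∨
    (label m (state m (p + 1)) = some p ∧ encl m (state m (p + 1)) = encl m (state m p)) := by
  have hv := valid_state m p
  have hn : state m (p + 1) = nextState m p (state m p) := rfl
  generalize hs : state m p = s at hv hn
  cases s with
  | done => exact absurd hn hd
  | hub st bits =>
    simp only [nextState] at hn
    split_ifs at hn with h
    · right; left
      rw [hn]
      exact ⟨rfl, rfl⟩
    · right; right; right; right
      rw [hn]
      have : popped m st.length 1 = 1 := by simp [popped]
      exact ⟨by simp [label], by simp [encl, this]⟩
  | wall u st bits j =>
    obtain ⟨h1, h2, h3, h4⟩ := hv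
    have hr := dip_le m st.length
    simp only [nextState] at hn
    by_cases h : j < wallLen m st.length
    · rw [if_pos h] at hn
      simp only [wallLen] at h h4
      by_cases hj : j ≤ dip m st.length
      · right; right; left
        have hlt : j < (u :: st).length := by simp; omega
        have e1 : popped m st.length j = j := by simp [popped]; omega
        have e2 : popped m st.length (j + 1) = j + 1 := by simp [popped]; omega
        have e3 : min (j + 1 - 1) (2 * dip m st.length + 2 - (j + 1)) = j := by omega
        have e4 : (u :: st).drop j = (u :: st)[j] :: (u :: st).drop (j + 1) :=
          List.drop_eq_getElem_cons hlt
        have e5 : openHubs (state m p) = (u :: st).take j ++ (u :: st)[j] :: (u :: st).drop (j + 1) := by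
          rw [hs, ← e4, List.take_append_drop]; rfl
        obtain ⟨f1, bt, f2⟩ := hub_of_openHubs e5
        refine ⟨(u :: st)[j], ?_, f1, ?_, ?_⟩
        · rw [hn]; simp only [label, e3]; exact List.getElem?_eq_getElem hlt
        · rw [hn]; simp only [encl, e1, e2]; exact e4
        · rw [hn, f2]; simp only [encl, e2]
      · right; right; right; left
        set c := 2 * dip m st.length + 1 - j with hc
        have hlt : c < (u :: st).length := by simp; omega
        have e1 : popped m st.length j = c + 1 := by simp [popped]; omega
        have e2 : popped m st.length (j + 1) = c := by simp [popped]; omega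
        have e3 : min (j + 1 - 1) (2 * dip m st.length + 2 - (j + 1)) = c := by omega
        have e4 : (u :: st).drop c = (u :: st)[c] :: (u :: st).drop (c + 1) :=
          List.drop_eq_getElem_cons hlt
        have e5 : openHubs (state m p) = (u :: st).take c ++ (u :: st)[c] :: (u :: st).drop (c + 1) := by
          rw [hs, ← e4, List.take_append_drop]; rfl
        obtain ⟨f1, bt, f2⟩ := hub_of_openHubs e5
        refine ⟨(u :: st)[c], ?_, f1, ?_, ?_⟩
        · rw [hn]; simp only [label, e3]; exact List.getElem?_eq_getElem hlt
        · rw [hn]; simp only [encl, e1, e2]; exact e4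
        · rw [f2]; simp only [encl, e1]
    · rw [if_neg h] at hn
      simp only [wallLen] at h h4
      have e1 : popped m st.length j = 1 := by simp [popped]; omega
      match st, bits with
      | st, false :: bs =>
        left
        rw [hn]
        exact ⟨rfl, by simp [encl, e1, afterWall], _, _, _, _, rfl⟩
      | u' :: st', true :: bs =>
        right; right; left
        have e5 : openHubs (state m p) = [u] ++ u' :: st' := by rw [hs]; rfl
        obtain ⟨f1, bt, f2⟩ := hub_of_openHubs e5
        have e6 : popped m st'.length 1 = 1 := by simp [popped]
        refine ⟨u', ?_, f1, ?_, ?_⟩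
        · rw [hn]; simp [afterWall, label]
        · rw [hn]; simp only [encl, e1, afterWall, e6]; rfl
        · rw [hn, f2]; simp [encl, afterWall, e6]
      | [], true :: bs => exact absurd hn hd
      | [], [] => exact absurd hn hd
      | _ :: _, [] => exact absurd hn hd

/-- The moves of a walk that do not return. -/
inductive Fwd (m : ℕ) : St → St → Prop
  | leave (u : ℕ) (st : List ℕ) (bits : List Bool) : Fwd m (St.hub st bits) (St.wall u st bits 1)
  | along (u : ℕ) (st : List ℕ) (bits : List Bool) (j : ℕ) (h : j < wallLen m st.length) :
      Fwd m (St.wall u st bits j) (St.wall u st bits (j + 1))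
  | sibling (u : ℕ) (st : List ℕ) (bs : List Bool) :
      Fwd m (St.wall u st (false :: bs) (wallLen m st.length)) (St.hub st (true :: bs))
  | parent (u u' : ℕ) (st : List ℕ) (bs : List Bool) :
      Fwd m (St.wall u (u' :: st) (true :: bs) (wallLen m (st.length + 1))) (St.wall u' st bs 1)

/-- The numerical part of the validity of a state. -/
def Ok (m : ℕ) : St → Prop
  | St.hub st bits => bits.length = st.length ∧ st.length ≤ 2 ^ m
  | St.wall _ st bits j => bits.length = st.length ∧ st.length ≤ 2 ^ m ∧ 1 ≤ j ∧
      j ≤ wallLen m st.length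
  | St.done => False

theorem ok_state {m p : ℕ} (h : state m p ≠ St.done) : Ok m (state m p) := by
  have hv := valid_state m p
  generalize hs : state m p = s at hv h
  cases s with
  | done => exact h rfl
  | hub st bits => exact ⟨hv.1, hv.2.1⟩
  | wall u st bits j =>
    obtain ⟨h1, h2, h3, h4⟩ := hv
    have hu := valid_state m u
    rw [h2] at hu
    exact ⟨hu.1, hu.2.1, h3, h4⟩

/-- Walls of depth `i` that cannot be crossed while keeping `e` hubs enclosing. -/
def Blocked (m e i : ℕ) : Prop := i - dip m i < e ∧ e ≤ i

instance (m e i : ℕ) : Decidable (Blocked m e i) := inferInstanceAs (Decidable (_ ∧ _))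

/-- The number of moves available in a wall of depth `i`. -/
def cap (m e i : ℕ) : ℕ := if Blocked m e i then i + 1 - e else wallLen m i

/-- The number of moves available in a wall of depth `i` from position `j` on. -/
def rem (m e i j : ℕ) : ℕ :=
  if Blocked m e i ∧ j ≤ dip m i + 1 then i + 1 - e - j else wallLen m i - j

/-- The number of moves available after the current wall. -/
def rest (m e : ℕ) : List Bool → ℕ
  | [] => 0
  | b :: bs => (if b then 0 else if e ≤ bs.length + 1 then 1 + cap m e (bs.length + 1) else 0) +
      (if e ≤ bs.length then cap m e bs.length else 0) + rest m e bs

/-- The number of forward moves available from a state. -/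
def pot (m e : ℕ) : St → ℕ
  | St.hub st bits => cap m e st.length + rest m e bits
  | St.wall _ st bits j => rem m e st.length j + rest m e bits
  | St.done => 0

theorem depth_ge_of_encl {m e : ℕ} {s : St} (hs : Ok m s) (h : e ≤ (encl m s).length) :
    e ≤ depth s := by
  cases s with
  | done => exact hs.elim
  | hub st bits => exact h
  | wall u st bits j =>
    obtain ⟨-, -, h3, h4⟩ := hs
    simp only [encl, List.length_drop, List.length_cons, popped, depth, wallLen] at *
    omega

theorem cap_pos {m e i : ℕ} (he : e ≤ i) : rem m e i 1 + 1 ≤ cap m e i := by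
  unfold rem cap wallLen
  by_cases h : Blocked m e i
  · simp [h]; omega
  · simp [h]

theorem rem_succ {m e i j : ℕ} (hj : j < wallLen m i)
    (h : e ≤ i + 1 - popped m i j) (h' : e ≤ i + 1 - popped m i (j + 1)) :
    rem m e i (j + 1) + 1 ≤ rem m e i j := by
  unfold rem wallLen popped Blocked at *
  split_ifs <;> omega

theorem pot_fwd {m e : ℕ} {s s' : St} (h : Fwd m s s') (hs : Ok m s) (hs' : Ok m s')
    (he : e ≤ (encl m s).length) (he' : e ≤ (encl m s').length) : pot m e s' + 1 ≤ pot m e s := by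
  have hd := depth_ge_of_encl hs he
  have hd' := depth_ge_of_encl hs' he'
  cases h with
  | leave u st bits =>
    have := cap_pos (m := m) hd
    simp only [pot, depth] at *
    omega
  | along u st bits j h =>
    simp only [encl, List.length_drop, List.length_cons] at he he'
    have := rem_succ h he he'
    simp only [pot]
    omega
  | sibling u st bs =>
    have h1 := hs.1
    simp only [List.length_cons] at h1
    simp only [pot, rest, h1, depth] at *
    simp [hd]
    omega
  | parent u u' st bs =>
    have h1 := hs.1
    simp only [List.length_cons, Nat.add_right_cancel_iff] at h1
    simp only [pot, rest, h1, depth] at *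
    have := cap_pos (m := m) hd'
    simp [hd']
    omega

theorem depth_fwd {m : ℕ} {s s' : St} (h : Fwd m s s') : depth s' ≤ depth s := by
  cases h <;> simp [depth]

/-- A bound for the potential of states of depth at most `D`. -/
def bnd (m e D : ℕ) : ℕ :=
  ∑ i ∈ Finset.range (D + 1), if e ≤ i then 1 + 2 * cap m e i else 0

theorem rest_le (m e : ℕ) (bits : List Bool) :
    rest m e bits + (if e ≤ bits.length then cap m e bits.length else 0) ≤
      bnd m e bits.length := by
  induction bits with
  | nil =>
    simp only [rest, bnd, List.length_nil, zero_add, Finset.sum_range_one]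
    split_ifs <;> omega
  | cons b bs ih =>
    rw [bnd, List.length_cons, Finset.sum_range_succ, ← bnd, rest]
    split_ifs at ih ⊢ <;> omega

theorem pot_le {m e : ℕ} {s : St} (hs : Ok m s) (he : e ≤ (encl m s).length) :
    pot m e s ≤ bnd m e (depth s) := by
  have hd := depth_ge_of_encl hs he
  cases s with
  | done => exact hs.elim
  | hub st bits =>
    have := rest_le m e bits
    have h1 := hs.1
    simp only [pot, depth] at *
    rw [h1, if_pos hd] at this
    omega
  | wall u st bits j =>
    have := rest_le m e bits
    obtain ⟨h1, h2, h3, h4⟩ := hs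
    simp only [pot, depth, encl, List.length_drop, List.length_cons] at *
    rw [h1, if_pos hd] at this
    have : rem m e st.length j ≤ cap m e st.length := by
      unfold rem cap wallLen popped at *
      split_ifs <;> (try simp only [Blocked] at *) <;> omega
    omega

/-- The states that are not yet stuck behind a wall of depth `i`. -/
def Above (m i : ℕ) (s : St) : Prop :=
  i < depth s ∨ (depth s = i ∧ ∀ u st bits j, s = St.wall u st bits j → j ≤ dip m i + 1)

theorem above_fwd {m e i : ℕ} (hb : Blocked m e i) {s s' : St} (h : Fwd m s s') (hs : Ok m s)
    (he : e ≤ (encl m s).length) (ha : Above m i s) : Above m i s' := by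
  obtain ⟨hb1, hb2⟩ := hb
  cases h with
  | leave u st bits =>
    rcases ha with h | ⟨h, -⟩
    · exact Or.inl h
    · refine Or.inr ⟨h, ?_⟩
      intro u st bits j h
      simp only [St.wall.injEq] at h
      omega
  | along u st bits j h =>
    rcases ha with h | ⟨h, h'⟩
    · exact Or.inl h
    · refine Or.inr ⟨h, ?_⟩
      intro u1 st1 bits1 j1 h1
      have := h' _ _ _ _ rfl
      simp only [St.wall.injEq] at h1
      simp only [encl, List.length_drop, List.length_cons, popped, depth] at *
      rw [h] at he
      omega
  | sibling u st bs =>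
    rcases ha with h | ⟨h, h'⟩
    · exact Or.inl h
    · refine Or.inr ⟨h, ?_⟩
      intro u1 st1 bits1 j1 h1
      cases h1
  | parent u u' st bs =>
    rcases ha with h | ⟨h, h'⟩
    · simp only [depth, List.length_cons] at h
      by_cases h1 : i < st.length
      · exact Or.inl h1
      · refine Or.inr ⟨by simp only [depth]; omega, ?_⟩
        intro u1 st1 bits1 j1 h1
        simp only [St.wall.injEq] at h1
        omega
    · have := h' _ _ _ _ rfl
      simp only [depth, List.length_cons] at h
      rw [h] at this
      simp only [wallLen] at this
      omega

theorem dip_ge {m i j : ℕ} (hj : j ≤ m) (h : 2 ^ j ∣ i) : min i (2 ^ (j + 2) - 2) ≤ dip m i := by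
  unfold dip
  refine min_le_min le_rfl ?_
  have h1 : ∑ k ∈ Finset.range (j + 1), 2 ^ (k + 1) ≤
      ∑ k ∈ Finset.range (m + 1), if 2 ^ k ∣ i then 2 ^ (k + 1) else 0 := by
    calc ∑ k ∈ Finset.range (j + 1), 2 ^ (k + 1)
        = ∑ k ∈ Finset.range (j + 1), if 2 ^ k ∣ i then 2 ^ (k + 1) else 0 := by
          refine Finset.sum_congr rfl fun k hk => ?_
          rw [if_pos ((pow_dvd_pow 2 (by simp at hk; omega)).trans h)]
      _ ≤ _ := Finset.sum_le_sum_of_subset (by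
          intro k hk; simp at *; omega)
  have h2 : ∀ j : ℕ, ∑ k ∈ Finset.range (j + 1), 2 ^ (k + 1) + 2 = 2 ^ (j + 2) := by
    intro j
    induction j with
    | zero => simp
    | succ j ih => rw [Finset.sum_range_succ, add_right_comm, ih]; ring
  have := h2 j
  omega

theorem exists_blocked {m e D : ℕ} (he : 1 ≤ e) (hD : D ≤ 2 ^ m) (hX : e + 1 ≤ D) :
    ∃ i, Blocked m e i ∧ i < D ∧ D + 1 - e ≤ 2 * (i + 1 - e) := by
  set X := D + 1 - e with hXd
  set j := Nat.log 2 (X / 2) with hj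
  have h1 : 2 ^ j ≤ X / 2 := Nat.pow_log_le_self 2 (by omega)
  have h2 : X / 2 < 2 ^ (j + 1) := Nat.lt_pow_succ_log_self (by norm_num) _
  have hjm : j ≤ m := by
    by_contra hc
    have : 2 ^ m ≤ 2 ^ j := Nat.pow_le_pow_right (by norm_num) (by omega)
    omega
  have h3 := Nat.div_add_mod (D - 1) (2 ^ j)
  have h5 := dip_ge (i := 2 ^ j * ((D - 1) / 2 ^ j)) hjm (Dvd.intro _ rfl)
  set i := 2 ^ j * ((D - 1) / 2 ^ j) with hi
  have h6 : 2 ^ (j + 2) = 2 * 2 ^ (j + 1) := by ring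
  refine ⟨i, ⟨?_, ?_⟩, ?_, ?_⟩ <;> omega

theorem card_multiples (d X q : ℕ) (hq : 0 < q) :
    ((Finset.Ioc d (d + X)).filter (q ∣ ·)).card ≤ X / q + 1 := by
  have h := Nat.Ioc_filter_dvd_card_eq_div (d + X) q
  have h' := Nat.Ioc_filter_dvd_card_eq_div d q
  have hu : (Finset.Ioc 0 (d + X)).filter (q ∣ ·) =
      (Finset.Ioc 0 d).filter (q ∣ ·) ∪ (Finset.Ioc d (d + X)).filter (q ∣ ·) := by
    ext a; simp; omega
  have hd : Disjoint ((Finset.Ioc 0 d).filter (q ∣ ·))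
      ((Finset.Ioc d (d + X)).filter (q ∣ ·)) := by
    rw [Finset.disjoint_left]; intro a; simp; omega
  rw [hu, Finset.card_union_of_disjoint hd, h'] at h
  have := Nat.add_div (a := d) (b := X) hq
  split_ifs at this <;> omega

theorem sum_min_dip_le (m d X : ℕ) :
    ∑ i ∈ Finset.Ioc d (d + X), min (dip m i) (i - d) ≤ 3 * (m + 1) * X := by
  calc ∑ i ∈ Finset.Ioc d (d + X), min (dip m i) (i - d)
      ≤ ∑ i ∈ Finset.Ioc d (d + X), ∑ j ∈ Finset.range (m + 1),
          if 2 ^ j ∣ i then min (2 ^ (j + 1)) X else 0 := by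
        refine Finset.sum_le_sum fun i hi => ?_
        have key : ∀ s : Finset ℕ, min (∑ j ∈ s, if 2 ^ j ∣ i then 2 ^ (j + 1) else 0) X ≤
            ∑ j ∈ s, if 2 ^ j ∣ i then min (2 ^ (j + 1)) X else 0 := by
          intro s
          induction s using Finset.induction_on with
          | empty => simp
          | insert a s ha ih =>
            rw [Finset.sum_insert ha, Finset.sum_insert ha]
            split_ifs <;> omega
        refine le_trans ?_ (key _)
        simp only [Finset.mem_Ioc] at hi
        unfold dip
        omega
    _ = ∑ j ∈ Finset.range (m + 1), ∑ i ∈ Finset.Ioc d (d + X),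
          if 2 ^ j ∣ i then min (2 ^ (j + 1)) X else 0 := Finset.sum_comm
    _ ≤ ∑ j ∈ Finset.range (m + 1), 3 * X := by
        refine Finset.sum_le_sum fun j _ => ?_
        rw [← Finset.sum_filter, Finset.sum_const, smul_eq_mul]
        have h := card_multiples d X (2 ^ j) (by positivity)
        have h1 : X / 2 ^ j * 2 ^ j ≤ X := Nat.div_mul_le_self _ _
        calc _ ≤ (X / 2 ^ j + 1) * min (2 ^ (j + 1)) X := Nat.mul_le_mul_right _ h
          _ = X / 2 ^ j * min (2 ^ (j + 1)) X + min (2 ^ (j + 1)) X := by ring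
          _ ≤ X / 2 ^ j * 2 ^ (j + 1) + X := by
              gcongr
              · exact min_le_left _ _
              · exact min_le_right _ _
          _ = 2 * (X / 2 ^ j * 2 ^ j) + X := by ring
          _ ≤ 3 * X := by omega
    _ = 3 * (m + 1) * X := by simp; ring

theorem bnd_le {m e D : ℕ} (he : e ≤ D) : bnd m e D ≤ 15 * (m + 1) * (D + 1 - e) + 3 := by
  set d := e - 1 with hd
  have h1 : bnd m e D ≤ 3 + ∑ i ∈ Finset.Ioc d (d + (D - d)), (3 + 4 * min (dip m i) (i - d)) := by
    have hsub : Finset.range (D + 1) ⊆ insert 0 (Finset.Ioc 0 D) := by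
      intro a; simp
    calc bnd m e D ≤ ∑ i ∈ insert 0 (Finset.Ioc 0 D), (if e ≤ i then 1 + 2 * cap m e i else 0) :=
          Finset.sum_le_sum_of_subset hsub
      _ ≤ 3 + ∑ i ∈ Finset.Ioc 0 D, (if e ≤ i then 1 + 2 * cap m e i else 0) := by
          rw [Finset.sum_insert (by simp)]
          gcongr
          have : dip m 0 = 0 := by simp [dip]
          unfold cap wallLen
          split_ifs <;> omega
      _ = 3 + ∑ i ∈ Finset.Ioc 0 D, (if d < i then (if e ≤ i then 1 + 2 * cap m e i else 0)
            else 0) := by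
          congr 1
          refine Finset.sum_congr rfl fun i hi => ?_
          simp only [Finset.mem_Ioc] at hi
          split_ifs <;> omega
      _ = 3 + ∑ i ∈ (Finset.Ioc 0 D).filter (d < ·),
            (if e ≤ i then 1 + 2 * cap m e i else 0) := by
          rw [Finset.sum_filter]
      _ ≤ 3 + ∑ i ∈ Finset.Ioc d (d + (D - d)), (if e ≤ i then 1 + 2 * cap m e i else 0) := by
          gcongr
          intro a; simp; omega
      _ ≤ _ := by
          gcongr with i hi
          simp only [Finset.mem_Ioc] at hi
          have := dip_le m i
          unfold cap wallLen
          split_ifs <;> (try simp only [Blocked] at *) <;> omega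
  rw [Finset.sum_add_distrib, ← Finset.mul_sum] at h1
  have h2 := sum_min_dip_le m d (D - d)
  simp only [Finset.sum_const, Nat.card_Ioc, smul_eq_mul] at h1
  have h3 : D - d ≤ D + 1 - e := by omega
  have h4 : 3 * (m + 1) * (D - d) ≤ 3 * (m + 1) * (D + 1 - e) := Nat.mul_le_mul_left _ h3
  have h5 : D + 1 - e ≤ (m + 1) * (D + 1 - e) := Nat.le_mul_of_pos_left _ (by omega)
  have h6 : 15 * (m + 1) * (D + 1 - e) = 12 * ((m + 1) * (D + 1 - e)) +
    3 * ((m + 1) * (D + 1 - e)) := by ring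
  have h7 : 3 * (m + 1) * (D + 1 - e) = 3 * ((m + 1) * (D + 1 - e)) := by ring
  omega

/-- The levels of the hubs that enclose a node of the binary tree. -/
def Encl (m : ℕ) (x : List Bool) : List ℕ := encl m (state m x.length)

/-- The node `z` is a hub enclosing the node `x`. -/
def In (m : ℕ) (z x : List Bool) : Prop := z <:+ x ∧ z.length ∈ Encl m x

/-- The edge leading to the node `e` is labelled by the hub `h`. -/
def Lb (m : ℕ) (e h : List Bool) : Prop :=
  h <:+ e ∧ label m (state m e.length) = some h.length

/-- A tree edge none of whose labels lies in `S`. -/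
def Link (m : ℕ) (S : Set (List Bool)) (x y : List Bool) : Prop :=
  ∃ b, y = b :: x ∧ ∀ h, Lb m y h → h ∉ S

/-- The node `x` is an endpoint of an edge labelled `h`. -/
def Jump (m : ℕ) (h x : List Bool) : Prop := ∃ e, Lb m e h ∧ (x = e ∨ ∃ b, e = b :: x)

/-- One step of a walk with set of nodes `S`. -/
def Step (m : ℕ) (S : Set (List Bool)) (x y : List Bool) : Prop :=
  Link m S x y ∨ Link m S y x ∨ Jump m x y ∨ Jump m y x

/-- The node `x` lies in a wall across which the hub `w`, now popped, is alive. -/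
def Zone (m : ℕ) (w x : List Bool) : Prop :=
  w <:+ x ∧ ∃ u st bits j, state m x.length = St.wall u st bits j ∧
    ∃ r, st[r]? = some w.length ∧ r + 1 < popped m st.length j

/-- A forward move along a tree edge. -/
def Down (m : ℕ) (S : Set (List Bool)) (x y : List Bool) : Prop :=
  Link m S x y ∧ ∃ u st bits j, state m x.length = St.wall u st bits j

/-- A move from a hub to the beginning of its wall. -/
def Leave (m : ℕ) (x y : List Bool) : Prop :=
  x <:+ y ∧ ∃ st bits, state m x.length = St.hub st bits ∧
    state m y.length = St.wall x.length st bits 1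

theorem eq_of_suffix {α : Type*} {a b x : List α} (ha : a <:+ x) (hb : b <:+ x)
    (h : a.length = b.length) : a = b :=
  (List.suffix_of_suffix_length_le ha hb h.le).eq_of_length h

theorem suffix_of_lt {α : Type*} {a x : List α} {b : α} (h : a <:+ b :: x)
    (hl : a.length < x.length + 1) : a <:+ x := by
  rcases List.suffix_cons_iff.1 h with rfl | h
  · simp at hl
  · exact h

theorem In.length_lt {m : ℕ} {z x : List Bool} (h : In m z x) : z.length < x.length :=
  lt_of_mem_encl h.2

theorem state_hub_of_In {m : ℕ} {z x : List Bool} (h : In m z x) :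
    ∃ bt, state m z.length = St.hub (Encl m z) bt := by
  obtain ⟨l₁, l₂, h⟩ := List.append_of_mem h.2
  obtain ⟨-, bt, h⟩ := hub_of_encl h
  refine ⟨bt, ?_⟩
  rw [Encl, encl_hub h, h]

theorem label_ne_done {m : ℕ} {s : St} {q : ℕ} (h : label m s = some q) : s ≠ St.done := by
  rintro rfl; simp [label] at h

theorem label_mem {m : ℕ} {s : St} {q : ℕ} (h : label m s = some q) : q ∈ openHubs s := by
  cases s with
  | done => simp [label] at h
  | hub st bits => simp [label] at h
  | wall u st bits j => exact List.mem_of_getElem? h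

theorem label_mem_parent {m p q : ℕ} (h : label m (state m (p + 1)) = some q) :
    q = p ∨ q ∈ openHubs (state m p) := by
  have hn : state m (p + 1) = nextState m p (state m p) := rfl
  rw [hn] at h
  cases hs : state m p with
  | done => simp [hs, nextState, label] at h
  | hub st bits =>
    left
    rw [hs, nextState] at h
    split_ifs at h
    · simp [label] at h
    · simpa [label, eq_comm] using h
  | wall u st bits j =>
    right
    rw [hs, nextState] at h
    split_ifs at h
    · have := label_mem h
      exact this
    · match st, bits with
      | _, false :: _ => simp [afterWall, label] at h
      | u' :: st', true :: bs =>
        have := label_mem h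
        simp only [afterWall, openHubs] at this ⊢
        exact List.mem_cons_of_mem _ this
      | [], true :: bs => simp [afterWall, label] at h
      | [], [] => simp [afterWall, label] at h
      | _ :: _, [] => simp [afterWall, label] at h

theorem jump_cases {m : ℕ} {h x : List Bool} (hj : Jump m h x) (hne : h ≠ x) :
    h <:+ x ∧ h.length < x.length ∧ h.length ∈ openHubs (state m x.length) ∧
      (Encl m x = Encl m h ∨ Encl m x = h.length :: Encl m h) := by
  obtain ⟨e, ⟨he, hl⟩, hx⟩ := hj
  have key : h.length ∈ openHubs (state m x.length) ∧
      (Encl m x = Encl m h ∨ Encl m x = h.length :: Encl m h) ∧ h.length < x.length := by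
    unfold Encl
    rcases hx with rfl | ⟨b, rfl⟩
    · cases x with
      | nil => simp [state, label] at hl
      | cons b p =>
        refine ⟨label_mem hl, ?_⟩
        simp only [List.length_cons] at hl ⊢
        rcases edge_cases m p.length (label_ne_done hl) with h1 | h1 | ⟨q, h1, h2⟩ | ⟨q, h1, h2⟩ | h1
        · simp [h1.1] at hl
        · simp [h1.1] at hl
        · have : q = h.length := by simpa [h1] using hl
          subst this
          exact ⟨Or.inl h2.2.2, by omega⟩
        · have : q = h.length := by simpa [h1] using hl
          subst this
          exact ⟨Or.inr (by rw [h2.2.1, h2.2.2]), by omega⟩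
        · have : p.length = h.length := by simpa [h1] using hl
          rw [← this]
          exact ⟨Or.inl h1.2, by omega⟩
    · simp only [List.length_cons] at hl
      rcases edge_cases m x.length (label_ne_done hl) with h1 | h1 | ⟨q, h1, h2⟩ | ⟨q, h1, h2⟩ | h1
      · simp [h1.1] at hl
      · simp [h1.1] at hl
      · have : q = h.length := by simpa [h1] using hl
        subst this
        refine ⟨(label_mem_parent hl).resolve_left (by omega), Or.inr (by rw [h2.2.1, h2.2.2]), h2.1⟩
      · have : q = h.length := by simpa [h1] using hl
        subst this
        exact ⟨(label_mem_parent hl).resolve_left (by omega), Or.inl h2.2.2, h2.1⟩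
      · have : x.length = h.length := by simpa [h1] using hl
        exact absurd (eq_of_suffix he (List.suffix_cons b x) this.symm) hne
  refine ⟨?_, key.2.2, key.1, key.2.1⟩
  rcases hx with rfl | ⟨b, rfl⟩
  · exact he
  · exact suffix_of_lt he (by omega)

theorem in_iff_of_jump {m : ℕ} {z h x : List Bool} (hj : Jump m h x) (hne : h ≠ x) (hz : z ≠ h) :
    In m z h ↔ In m z x := by
  obtain ⟨h1, h2, -, h3⟩ := jump_cases hj hne
  constructor
  · rintro ⟨a, b⟩
    refine ⟨a.trans h1, ?_⟩
    rcases h3 with h3 | h3 <;> rw [h3]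
    · exact b
    · exact List.mem_cons_of_mem _ b
  · rintro ⟨a, b⟩
    have hb : z.length ∈ Encl m h := by
      rcases h3 with h3 | h3 <;> rw [h3] at b
      · exact b
      · rcases List.mem_cons.1 b with b | b
        · exact absurd (eq_of_suffix a h1 b) hz
        · exact b
    exact ⟨List.suffix_of_suffix_length_le a h1 (lt_of_mem_encl hb).le, hb⟩

theorem in_iff_of_link {m : ℕ} {S : Set (List Bool)} {z x y : List Bool} (hl : Link m S x y)
    (ha : state m y.length ≠ St.done) (hz : z ∈ S) (hne : z ≠ x) : In m z x ↔ In m z y := by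
  obtain ⟨b, rfl, hS⟩ := hl
  have hsx : In m z (b :: x) → z <:+ x := fun h => suffix_of_lt h.1 (by simpa using h.length_lt)
  have hxs : z <:+ x → z <:+ b :: x := fun h => h.trans (List.suffix_cons b x)
  have hlab : ∀ q, label m (state m (x.length + 1)) = some q → z <:+ x → z.length ≠ q := by
    rintro q hq hzx rfl
    exact hS z ⟨hxs hzx, hq⟩ hz
  simp only [List.length_cons] at ha
  constructor
  · intro h
    refine ⟨hxs h.1, ?_⟩
    have h0 := h.2
    simp only [Encl, List.length_cons] at h0 ⊢
    rcases edge_cases m x.length ha with h1 | h1 | ⟨q, h1, h2⟩ | ⟨q, h1, h2⟩ | h1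
    · rwa [h1.2.1]
    · rw [h1.2]; exact List.mem_cons_of_mem _ h0
    · rw [h2.2.1] at h0
      exact (List.mem_cons.1 h0).resolve_left (hlab _ h1 h.1)
    · rw [h2.2.1]; exact List.mem_cons_of_mem _ h0
    · rwa [h1.2]
  · intro h
    have hzx := hsx h
    refine ⟨hzx, ?_⟩
    have h0 := h.2
    simp only [Encl, List.length_cons] at h0 ⊢
    rcases edge_cases m x.length ha with h1 | h1 | ⟨q, h1, h2⟩ | ⟨q, h1, h2⟩ | h1
    · rwa [h1.2.1] at h0
    · rw [h1.2] at h0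
      exact (List.mem_cons.1 h0).resolve_left fun h' => hne (hzx.eq_of_length h')
    · rw [h2.2.1]; exact List.mem_cons_of_mem _ h0
    · rw [h2.2.1] at h0
      exact (List.mem_cons.1 h0).resolve_left (hlab _ h1 hzx)
    · rwa [h1.2] at h0

theorem in_iff_of_step {m : ℕ} {S : Set (List Bool)} {z x y : List Bool} (hs : Step m S x y)
    (hxy : x ≠ y) (hax : state m x.length ≠ St.done) (hay : state m y.length ≠ St.done)
    (hz : z ∈ S) (hzx : z ≠ x) (hzy : z ≠ y) : In m z x ↔ In m z y := by
  rcases hs with h | h | h | h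
  · exact in_iff_of_link h hay hz hzx
  · exact (in_iff_of_link h hax hz hzy).symm
  · exact in_iff_of_jump h hxy hzx
  · exact (in_iff_of_jump h hxy.symm hzy).symm

theorem Down.fwd {m : ℕ} {S : Set (List Bool)} {x y : List Bool} (h : Down m S x y)
    (ha : state m y.length ≠ St.done) : Fwd m (state m x.length) (state m y.length) := by
  obtain ⟨⟨b, rfl, -⟩, u, st, bits, j, hs⟩ := h
  have hv := valid_state m x.length
  rw [hs] at hv
  have hu := valid_state m u
  rw [hv.2.1] at hu
  have hn : state m (x.length + 1) = nextState m x.length (state m x.length) := rfl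
  simp only [List.length_cons] at ha ⊢
  rw [hs, nextState] at hn
  rw [hs]
  split_ifs at hn with h <;> rw [hn] at ha ⊢
  · exact Fwd.along _ _ _ _ h
  · have hj : j = wallLen m st.length := le_antisymm hv.2.2.2 (by omega)
    subst hj
    match st, bits with
    | _, false :: _ => exact Fwd.sibling _ _ _
    | u' :: st', true :: bs => exact Fwd.parent _ _ _ _
    | [], true :: bs => exact absurd rfl ha
    | [], [] => exact absurd rfl ha
    | _ :: _, [] => exact absurd rfl ha

theorem Leave.fwd {m : ℕ} {x y : List Bool} (h : Leave m x y) :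
    Fwd m (state m x.length) (state m y.length) := by
  obtain ⟨-, st, bits, h1, h2⟩ := h
  rw [h1, h2]
  exact Fwd.leave _ _ _

theorem Leave.lb {m : ℕ} {x y : List Bool} (h : Leave m x y) : Lb m y x := by
  obtain ⟨h0, st, bits, h1, h2⟩ := h
  refine ⟨h0, ?_⟩
  rw [h2]
  simp [label]

theorem Zone.not_hub {m : ℕ} {w x : List Bool} {st bits} (h : Zone m w x) :
    state m x.length ≠ St.hub st bits := by
  obtain ⟨-, u, st', bits', j, h, -⟩ := h
  rw [h]; simp

theorem Zone.hub {m : ℕ} {w x : List Bool} (h : Zone m w x) :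
    w.length < x.length ∧ ∃ bt, state m w.length = St.hub (Encl m w) bt := by
  obtain ⟨-, u, st, bits, j, h, r, h1, -⟩ := h
  obtain ⟨hr, h1⟩ := List.getElem?_eq_some_iff.1 h1
  have : openHubs (state m x.length) = (u :: st.take r) ++ w.length :: st.drop (r + 1) := by
    rw [h, ← h1, List.cons_append, ← List.drop_eq_getElem_cons, List.take_append_drop]; rfl
  obtain ⟨h2, bt, h3⟩ := hub_of_openHubs this
  exact ⟨h2, bt, by rw [Encl, encl_hub h3, h3]⟩

/-- A jump that does not change the enclosing hubs. -/
theorem flat_jump {m : ℕ} {h x : List Bool} (hj : Jump m h x) (hne : h ≠ x)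
    (hax : state m x.length ≠ St.done) (hf : ¬ In m h x) :
    (Leave m h x ∨ ∃ st bt, state m h.length = St.hub st bt ∧ Zone m h x) ∧
      Encl m x = Encl m h := by
  obtain ⟨h1, h2, h3, h4⟩ := jump_cases hj hne
  have hE : Encl m x = Encl m h := by
    refine h4.resolve_right fun h4 => hf ⟨h1, ?_⟩
    rw [h4]; exact List.mem_cons_self
  refine ⟨?_, hE⟩
  obtain ⟨l₁, l₂, h5⟩ := List.append_of_mem h3
  obtain ⟨-, bt, h6⟩ := hub_of_openHubs h5
  have hv := valid_state m x.length
  have hE' : encl m (state m x.length) = l₂ := by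
    rw [← encl_hub h6]; exact hE
  generalize hs : state m x.length = s at h5 hv hE' hax
  cases s with
  | done => exact absurd rfl hax
  | hub st bits =>
    simp only [openHubs, encl] at h5 hE'
    rw [hE'] at h5
    have := congrArg List.length h5
    simp at this
    omega
  | wall u st bits j =>
    obtain ⟨v1, v2, v3, v4⟩ := hv
    simp only [openHubs, encl] at h5 hE'
    have hl := congrArg List.length h5
    have hl' := congrArg List.length hE'
    have hr := dip_le m st.length
    simp only [List.length_cons, List.length_append, List.length_drop, wallLen] at hl hl' v4
    have hc : popped m st.length j = l₁.length + 1 := by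
      unfold popped at hl' ⊢; omega
    cases l₁ with
    | nil =>
      simp only [List.nil_append, List.cons.injEq] at h5
      obtain ⟨h5, rfl⟩ := h5
      by_cases hj1 : j = 1
      · left
        subst hj1 h5
        exact ⟨h1, _, _, v2, hs⟩
      · exfalso
        have hj2 : j = 2 * dip m st.length + 1 := by
          unfold popped at hc; simp only [List.length_nil] at hc; omega
        obtain ⟨e, ⟨he, hl⟩, rfl | ⟨b, rfl⟩⟩ := hj
        · rw [hs] at hl
          have : min (j - 1) (2 * dip m st.length + 2 - j) = 1 := by omega
          simp only [label, this, List.getElem?_cons_succ] at hl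
          have hm := List.mem_of_getElem? hl
          rw [h5] at v2
          have := lt_of_mem_encl (m := m) (p := h.length) (q := h.length) (by rw [v2]; exact hm)
          omega
        · have hn : state m (x.length + 1) = nextState m x.length (state m x.length) := rfl
          simp only [List.length_cons] at hl
          rw [hn, hs, nextState, if_neg (by simp only [wallLen]; omega)] at hl
          match st, bits with
          | _, false :: _ => simp [afterWall, label] at hl
          | u' :: st', true :: bs =>
            simp only [afterWall] at hl
            have hm := label_mem hl
            simp only [openHubs] at hm
            rw [h5] at v2
            have := lt_of_mem_encl (m := m) (p := h.length) (q := h.length) (by rw [v2]; exact hm)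
            omega
          | [], true :: bs => simp [afterWall, label] at hl
          | [], [] => simp [afterWall, label] at hl
          | _ :: _, [] => simp [afterWall, label] at hl
    | cons a l =>
      right
      simp only [List.cons_append, List.cons.injEq] at h5
      obtain ⟨rfl, rfl⟩ := h5
      refine ⟨_, _, h6, h1, _, _, _, _, hs, l.length, by simp, ?_⟩
      rw [hc]; simp

/-- The classification of the steps that do not change the enclosing hubs. -/
theorem flat_cases {m : ℕ} {S : Set (List Bool)} {x y : List Bool} (hs : Step m S x y)
    (hxy : x ≠ y) (hax : state m x.length ≠ St.done) (hay : state m y.length ≠ St.done)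
    (hx : x ∈ S) (hy : y ∈ S) (h1 : ¬ In m x y) (h2 : ¬ In m y x) :
    (Down m S x y ∨ Leave m x y) ∨ (Down m S y x ∨ Leave m y x) ∨
      ((∃ st bt, state m x.length = St.hub st bt) ∧ Zone m x y) ∨
      (Zone m y x ∧ Encl m x = Encl m y) := by
  have key : ∀ {x y : List Bool}, Link m S x y → state m x.length ≠ St.done →
      state m y.length ≠ St.done → x ∈ S → ¬ In m x y → Down m S x y := by
    intro x y hl hax hay hx h1
    refine ⟨hl, ?_⟩
    obtain ⟨b, rfl, hS⟩ := hl
    have hn : state m (x.length + 1) = nextState m x.length (state m x.length) := rfl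
    cases hs : state m x.length with
    | done => exact absurd hs hax
    | wall u st bits j => exact ⟨_, _, _, _, rfl⟩
    | hub st bits =>
      exfalso
      rw [hs, nextState] at hn
      split_ifs at hn
      · refine h1 ⟨List.suffix_cons _ _, ?_⟩
        simp [Encl, hn, encl]
      · refine hS x ⟨List.suffix_cons _ _, ?_⟩ hx
        simp [hn, label]
  rcases hs with h | h | h | h
  · exact Or.inl (Or.inl (key h hax hay hx h1))
  · exact Or.inr (Or.inl (Or.inl (key h hay hax hy h2)))
  · obtain ⟨h | ⟨st, bt, h, h'⟩, -⟩ := flat_jump h hxy hay h1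
    · exact Or.inl (Or.inr h)
    · exact Or.inr (Or.inr (Or.inl ⟨⟨st, bt, h⟩, h'⟩))
  · obtain ⟨h | ⟨st, bt, h, h'⟩, hE⟩ := flat_jump h hxy.symm hax h2
    · exact Or.inr (Or.inl (Or.inr h))
    · exact Or.inr (Or.inr (Or.inr ⟨h', hE⟩))

/-- Zones do not change along forward tree edges. -/
theorem zone_iff {m : ℕ} {S : Set (List Bool)} {w x y : List Bool} (h : Down m S x y)
    (hw : w ∈ S) : Zone m w x ↔ Zone m w y := by
  obtain ⟨⟨b, rfl, hS⟩, u, st, bits, j, hs⟩ := h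
  have hn : state m (x.length + 1) = nextState m x.length (state m x.length) := rfl
  have hv := valid_state m x.length
  rw [hs] at hv
  obtain ⟨-, -, v3, v4⟩ := hv
  rw [hs, nextState] at hn
  by_cases hj : j < wallLen m st.length
  · rw [if_pos hj] at hn
    have hlab : ∀ r, st[r]? = some w.length → w <:+ b :: x →
        min j (2 * dip m st.length + 1 - j) ≠ r + 1 := by
      intro r hr hwx hm
      refine hS w ⟨hwx, ?_⟩ hw
      have e1 : min (j + 1 - 1) (2 * dip m st.length + 2 - (j + 1)) = r + 1 := by omega
      rw [List.length_cons, hn, label, e1, List.getElem?_cons_succ, hr]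
    constructor
    · rintro ⟨hwx, u', st', bits', j', hs', r, h1, h2⟩
      rw [hs] at hs'
      cases hs'
      have hwx' := hwx.trans (List.suffix_cons b x)
      refine ⟨hwx', _, _, _, _, hn, r, h1, ?_⟩
      have := hlab r h1 hwx'
      unfold popped wallLen at *
      omega
    · intro hz
      have hlt := hz.hub.1
      obtain ⟨hwx, u', st', bits', j', hs', r, h1, h2⟩ := hz
      rw [List.length_cons, hn] at hs'
      cases hs'
      refine ⟨suffix_of_lt hwx (by simpa using hlt), _, _, _, _, hs, r, h1, ?_⟩
      have := hlab r h1 hwx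
      unfold popped wallLen at *
      omega
  · rw [if_neg hj] at hn
    constructor
    · rintro ⟨-, u', st', bits', j', hs', r, h1, h2⟩
      rw [hs] at hs'
      cases hs'
      unfold popped wallLen at *
      omega
    · rintro ⟨-, u', st', bits', j', hs', r, h1, h2⟩
      exfalso
      rw [List.length_cons, hn] at hs'
      match st, bits with
      | _, false :: _ => simp [afterWall] at hs'
      | u1 :: st1, true :: bs =>
        simp only [afterWall, St.wall.injEq] at hs'
        unfold popped at h2
        omega
      | [], true :: bs => simp [afterWall] at hs'
      | [], [] => simp [afterWall] at hs'
      | _ :: _, [] => simp [afterWall] at hs'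

/-- A walk with distinct nodes in `S`, of length `n`. -/
structure IsWalk (m : ℕ) (S : Set (List Bool)) (x : ℕ → List Bool) (n : ℕ) : Prop where
  mem : ∀ i ≤ n, x i ∈ S
  alive : ∀ i ≤ n, state m (x i).length ≠ St.done
  inj : ∀ i ≤ n, ∀ j ≤ n, x i = x j → i = j
  step : ∀ i < n, Step m S (x i) (x (i + 1))

/-- No step of the walk enters or leaves the region enclosed by a hub. -/
def IsFlat (m : ℕ) (x : ℕ → List Bool) (n : ℕ) : Prop :=
  ∀ i < n, ¬ In m (x i) (x (i + 1)) ∧ ¬ In m (x (i + 1)) (x i)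

theorem Step.symm {m : ℕ} {S : Set (List Bool)} {x y : List Bool} (h : Step m S x y) :
    Step m S y x := by
  rcases h with h | h | h | h
  · exact Or.inr (Or.inl h)
  · exact Or.inl h
  · exact Or.inr (Or.inr (Or.inr h))
  · exact Or.inr (Or.inr (Or.inl h))

section Walks
variable {m : ℕ} {S : Set (List Bool)} {x : ℕ → List Bool} {n : ℕ}

theorem IsWalk.shift (h : IsWalk m S x n) {a k : ℕ} (ha : a + k ≤ n) :
    IsWalk m S (fun i => x (a + i)) k where
  mem i hi := h.mem _ (by omega)
  alive i hi := h.alive _ (by omega)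
  inj i hi j hj e := by have := h.inj _ (by omega) _ (by omega) e; omega
  step i hi := h.step _ (by omega)

theorem IsWalk.reverse (h : IsWalk m S x n) {a k : ℕ} (ha : a ≤ n) (hk : k ≤ a) :
    IsWalk m S (fun i => x (a - i)) k where
  mem i hi := h.mem _ (by omega)
  alive i hi := h.alive _ (by omega)
  inj i hi j hj e := by have := h.inj _ (by omega) _ (by omega) e; omega
  step i hi := by
    have := (h.step (a - (i + 1)) (by omega)).symm
    have e : a - (i + 1) + 1 = a - i := by omega
    rwa [e] at this

theorem IsFlat.shift (h : IsFlat m x n) {a k : ℕ} (ha : a + k ≤ n) :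
    IsFlat m (fun i => x (a + i)) k := fun i hi => h (a + i) (by omega)

theorem IsFlat.reverse (h : IsFlat m x n) {a k : ℕ} (ha : a ≤ n) (hk : k ≤ a) :
    IsFlat m (fun i => x (a - i)) k := by
  intro i hi
  have := h (a - (i + 1)) (by omega)
  have e : a - (i + 1) + 1 = a - i := by omega
  rw [e] at this
  exact ⟨this.2, this.1⟩

theorem IsWalk.in_iff (h : IsWalk m S x n) {z : List Bool} (hz : z ∈ S) {a b : ℕ} (hab : a ≤ b)
    (hb : b ≤ n) (hne : ∀ i, a ≤ i → i ≤ b → z ≠ x i) : In m z (x a) ↔ In m z (x b) := by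
  induction b, hab using Nat.le_induction with
  | base => rfl
  | succ b hab ih =>
    rw [ih (by omega) fun i h1 h2 => hne i h1 (by omega)]
    refine in_iff_of_step (h.step b (by omega)) ?_ (h.alive _ (by omega)) (h.alive _ hb) hz
      (hne _ hab (by omega)) (hne _ (by omega) le_rfl)
    intro e
    have := h.inj _ (by omega) _ hb e
    omega

/-- A flat walk from its lowest node moves forward until it enters a zone, which it never
leaves. -/
theorem exists_forward (h : IsWalk m S x n) (hf : IsFlat m x n)
    (hmin : ∀ i ≤ n, (x 0).length ≤ (x i).length) :
    ∃ k ≤ n, (∀ i < k, Down m S (x i) (x (i + 1)) ∨ Leave m (x i) (x (i + 1))) ∧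
      (∀ i, k < i → i ≤ n → Zone m (x k) (x i)) ∧
      (∀ i, k < i → i < n → Link m S (x i) (x (i + 1)) ∨ Link m S (x (i + 1)) (x i)) := by
  classical
  by_cases hall : ∀ i < n, Down m S (x i) (x (i + 1)) ∨ Leave m (x i) (x (i + 1))
  · exact ⟨n, le_rfl, hall, fun i h1 h2 => by omega, fun i h1 h2 => by omega⟩
  push Not at hall
  have hex : ∃ k, k < n ∧ ¬ Down m S (x k) (x (k + 1)) ∧ ¬ Leave m (x k) (x (k + 1)) := hall
  obtain ⟨hkn, hk1, hk2⟩ := Nat.find_spec hex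
  have hfw : ∀ i < Nat.find hex, Down m S (x i) (x (i + 1)) ∨ Leave m (x i) (x (i + 1)) := by
    intro i hi
    have := Nat.find_min hex hi
    by_contra hc
    push Not at hc
    exact this ⟨by omega, hc⟩
  generalize Nat.find hex = k at hkn hk1 hk2 hfw
  have hne : ∀ i < n, x i ≠ x (i + 1) := fun i hi e => by
    have := h.inj _ (by omega) _ (by omega) e; omega
  have hinv : ∀ i ≤ k, ∀ w ∈ S, Zone m w (x i) → w.length < (x 0).length := by
    intro i
    induction i with
    | zero => intro _ w _ hw; exact hw.hub.1
    | succ i ih =>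
      intro hi w hw hz
      rcases hfw i (by omega) with h1 | h1
      · exact ih (by omega) w hw ((zone_iff h1 hw).2 hz)
      · exfalso
        obtain ⟨-, st, bits, -, h2⟩ := h1
        obtain ⟨-, u, st', bits', j, h3, r, -, h4⟩ := hz
        rw [h2] at h3
        cases h3
        unfold popped at h4
        omega
  have hxk := h.mem k (by omega)
  have hzone0 : Zone m (x k) (x (k + 1)) := by
    obtain ⟨hf1, hf2⟩ := hf k hkn
    rcases flat_cases (h.step k hkn) (hne k hkn) (h.alive _ (by omega)) (h.alive _ (by omega))
      hxk (h.mem _ (by omega)) hf1 hf2 with h1 | h1 | h1 | h1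
    · exact absurd h1 (by tauto)
    · exfalso
      have hlt : (x (k + 1)).length < (x k).length := by
        rcases h1 with ⟨⟨b, h1, -⟩, -⟩ | ⟨-, st, bits, -, h1⟩
        · rw [h1]; simp
        · have := valid_state m (x k).length
          rw [h1] at this
          exact this.1
      cases k with
      | zero => have := hmin 1 (by omega); simp only [zero_add] at hlt; omega
      | succ k =>
        have hne2 : x k ≠ x (k + 1 + 1) := fun e => by
          have := h.inj _ (by omega) _ (by omega) e; omega
        rcases hfw k (by omega) with h2 | h2 <;> rcases h1 with h1 | h1
        · obtain ⟨⟨b, h2, -⟩, -⟩ := h2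
          obtain ⟨⟨b', h1, -⟩, -⟩ := h1
          rw [h2] at h1
          simp only [List.cons.injEq] at h1
          exact hne2 h1.2
        · obtain ⟨⟨b, h2, hS⟩, -⟩ := h2
          exact hS _ h1.lb (h.mem _ (by omega))
        · obtain ⟨⟨b, -, hS⟩, -⟩ := h1
          exact hS _ h2.lb (h.mem _ (by omega))
        · obtain ⟨s1, st, bits, -, h1⟩ := h1
          obtain ⟨s2, st', bits', -, h2⟩ := h2
          rw [h1] at h2
          simp only [St.wall.injEq] at h2
          exact hne2 (eq_of_suffix s2 s1 h2.1.symm)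
    · exact h1.2
    · exfalso
      have := hinv k le_rfl _ (h.mem _ (by omega)) h1.1
      have := hmin (k + 1) (by omega)
      omega
  have main : ∀ i, k < i → i < n → Zone m (x k) (x i) → Zone m (x k) (x (i + 1)) ∧
      (Link m S (x i) (x (i + 1)) ∨ Link m S (x (i + 1)) (x i)) := by
    intro i hki hin hz
    obtain ⟨hf1, hf2⟩ := hf i hin
    rcases flat_cases (h.step i hin) (hne i hin) (h.alive _ (by omega)) (h.alive _ (by omega))
      (h.mem _ (by omega)) (h.mem _ (by omega)) hf1 hf2 with (h1 | h1) | (h1 | h1) | h1 | h1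
    · exact ⟨(zone_iff h1 hxk).1 hz, Or.inl h1.1⟩
    · obtain ⟨-, st, bits, h1, -⟩ := h1
      exact absurd h1 hz.not_hub
    · exact ⟨(zone_iff h1 hxk).2 hz, Or.inr h1.1⟩
    · exfalso
      obtain ⟨-, st, bits, -, h2⟩ := h1
      obtain ⟨-, u, st', bits', j, h3, r, -, h4⟩ := hz
      rw [h2] at h3
      cases h3
      unfold popped at h4
      omega
    · obtain ⟨⟨st, bits, h1⟩, -⟩ := h1
      exact absurd h1 hz.not_hub
    · exfalso
      obtain ⟨hz', hE⟩ := h1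
      obtain ⟨bt, hw⟩ := hz.hub.2
      obtain ⟨bt', hw'⟩ := hz'.hub.2
      obtain ⟨s1, u, st, bits, j, hs, r, hr, hc⟩ := hz
      obtain ⟨s2, u', st', bits', j', hs', r', hr', hc'⟩ := hz'
      rw [hs] at hs'
      cases hs'
      have hneq : x (i + 1) ≠ x k := fun e => by
        have := h.inj _ (by omega) _ (by omega) e; omega
      have hpos : ∀ {r q}, st[r]? = some q → ∃ bt, state m q = St.hub (st.drop (r + 1)) bt := by
        intro r q hr
        obtain ⟨hr, h1⟩ := List.getElem?_eq_some_iff.1 hr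
        have : openHubs (state m (x i).length) = (u :: st.take r) ++ q :: st.drop (r + 1) := by
          rw [hs, ← h1, List.cons_append, ← List.drop_eq_getElem_cons, List.take_append_drop]; rfl
        exact (hub_of_openHubs this).2
      obtain ⟨b1, e1⟩ := hpos hr
      obtain ⟨b2, e2⟩ := hpos hr'
      rw [e1] at hw
      rw [e2] at hw'
      simp only [St.hub.injEq] at hw hw'
      have hlen := congrArg List.length hE
      rw [← hw'.1, Encl, hs] at hlen
      simp only [encl, List.length_drop, List.length_cons] at hlen
      have hrr : r ≤ r' := by
        have := (List.getElem?_eq_some_iff.1 hr).1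
        omega
      have hin' : In m (x (i + 1)) (x k) := by
        have hmem : (x (i + 1)).length ∈ Encl m (x k) := by
          rw [← hw.1]
          refine List.mem_of_getElem? (i := r' - (r + 1)) ?_
          have : r ≠ r' := by
            rintro rfl
            rw [hr] at hr'
            exact hneq (eq_of_suffix s2 s1 (by simpa using hr'.symm))
          rw [List.getElem?_drop, ← hr']
          congr 1
          omega
        exact ⟨List.suffix_of_suffix_length_le s2 s1 (lt_of_mem_encl hmem).le, hmem⟩
      have := (h.in_iff (h.mem (i + 1) (by omega)) hki.le hin.le (fun a _ _ e => by
        have := h.inj _ (by omega) _ (by omega) e; omega)).1 hin'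
      have := this.2
      rw [hE] at this
      exact absurd (lt_of_mem_encl this) (lt_irrefl _)
  have hz : ∀ i, k < i → i ≤ n → Zone m (x k) (x i) := by
    intro i hi
    induction i, hi using Nat.le_induction with
    | base => intro _; exact hzone0
    | succ i hi ih => intro hin; exact (main i hi (by omega) (ih (by omega))).1
  exact ⟨k, by omega, hfw, hz, fun i h1 h2 => (main i h1 h2 (hz i h1 h2.le)).2⟩

/-- A path along tree edges visits each level at most twice. -/
theorem level_twice {a b : ℕ} (hinj : ∀ i, a ≤ i → i ≤ b → ∀ j, a ≤ j → j ≤ b → x i = x j → i = j)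
    (hl : ∀ i, a ≤ i → i < b → (∃ c, x (i + 1) = c :: x i) ∨ ∃ c, x i = c :: x (i + 1))
    {p q r : ℕ} (hp : a ≤ p) (hpq : p < q) (hqr : q < r) (hr : r ≤ b)
    (h1 : (x p).length = (x q).length) (h2 : (x q).length = (x r).length) : False := by
  have up : ∀ i, a ≤ i → ∀ j, i < j → j ≤ b → (∃ c, x (i + 1) = c :: x i) →
      (∃ c, x j = c :: x (j - 1)) ∧ (x i).length < (x j).length := by
    intro i hi j hij
    induction j, hij using Nat.le_induction with
    | base =>
      rintro _ ⟨c, hc⟩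
      exact ⟨⟨c, by simpa using hc⟩, by simp [hc]⟩
    | succ j hij ih =>
      intro hj hc
      obtain ⟨⟨c, h3⟩, h4⟩ := ih (by omega) hc
      rcases hl j (by omega) (by omega) with ⟨c', h5⟩ | ⟨c', h5⟩
      · exact ⟨⟨c', by simpa using h5⟩, by rw [h5, List.length_cons]; omega⟩
      · rw [h5] at h3
        simp only [List.cons.injEq] at h3
        have := hinj _ (by omega) hj _ (by omega) (by omega) h3.2
        omega
  rcases hl p hp (by omega) with h3 | h3
  · have := (up p hp q hpq (by omega) h3).2
    omega
  rcases hl q (by omega) (by omega) with h4 | h4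
  · have := (up q (by omega) r hqr (by omega) h4).2
    omega
  have down : ∀ i, p ≤ i → i ≤ q → (x q).length + (q - i) ≤ (x i).length := by
    intro i hi hiq
    induction hk : q - i generalizing i with
    | zero => have : i = q := by omega
              subst this; omega
    | succ k ih =>
      have h5 := ih (i + 1) (by omega) (by omega) (by omega)
      rcases hl i (by omega) (by omega) with h6 | ⟨c, h6⟩
      · exfalso
        obtain ⟨c, h7⟩ := (up i (by omega) (q + 1) (by omega) (by omega) h6).1
        obtain ⟨c', h8⟩ := h4
        simp only [Nat.add_sub_cancel] at h7
        have := congrArg List.length h7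
        have := congrArg List.length h8
        simp at *
        omega
      · rw [h6, List.length_cons]; omega
  have := down p le_rfl hpq.le
  omega

theorem zone_card {e k : ℕ} {w : List Bool} (h : IsWalk m S x n)
    (hz : ∀ i, k < i → i ≤ n → Zone m w (x i))
    (hl : ∀ i, k < i → i < n → Link m S (x i) (x (i + 1)) ∨ Link m S (x (i + 1)) (x i))
    (he : ∀ i ≤ n, e ≤ (Encl m (x i)).length) :
    n - k ≤ 4 * ((Encl m w).length + 1 - e) := by
  classical
  by_cases hkn : n ≤ k
  · omega
  push Not at hkn
  obtain ⟨s1, u, st, bits, j, hs, r, hr, hc⟩ := hz (k + 1) (by omega) (by omega)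
  have hsame : ∀ i, k < i → i ≤ n → ∃ j', state m (x i).length = St.wall u st bits j' ∧
      (x i).length + j = (x (k + 1)).length + j' := by
    intro i hi
    induction i, hi using Nat.le_induction with
    | base => intro _; exact ⟨j, hs, rfl⟩
    | succ i hi ih =>
      intro hin
      obtain ⟨j', h1, h2⟩ := ih (by omega)
      have hstep : ∀ {p q : List Bool}, Link m S p q → Zone m w p → Zone m w q →
          ∃ u st bits j, state m p.length = St.wall u st bits j ∧
            state m q.length = St.wall u st bits (j + 1) ∧ q.length = p.length + 1 := by
        rintro p q ⟨b, rfl, -⟩ hp hq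
        obtain ⟨-, u, st, bits, j, hs, -⟩ := hp
        refine ⟨u, st, bits, j, hs, ?_, by simp⟩
        have hn : state m (p.length + 1) = nextState m p.length (state m p.length) := rfl
        rw [hs, nextState] at hn
        rw [List.length_cons]
        split_ifs at hn with hj
        · exact hn
        · exfalso
          obtain ⟨-, u', st', bits', j', hs', r', -, hr'⟩ := hq
          rw [List.length_cons, hn] at hs'
          match st, bits with
          | _, false :: _ => simp [afterWall] at hs'
          | u1 :: st1, true :: bs =>
            simp only [afterWall, St.wall.injEq] at hs'
            unfold popped at hr'
            omega
          | [], true :: bs => simp [afterWall] at hs'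
          | [], [] => simp [afterWall] at hs'
          | _ :: _, [] => simp [afterWall] at hs'
      rcases hl i hi (by omega) with h3 | h3
      · obtain ⟨u', st', bits', j1, h4, h5, h6⟩ :=
          hstep h3 (hz i hi (by omega)) (hz _ (by omega) hin)
        rw [h1] at h4
        cases h4
        exact ⟨_, h5, by omega⟩
      · obtain ⟨u', st', bits', j1, h4, h5, h6⟩ :=
          hstep h3 (hz _ (by omega) hin) (hz i hi (by omega))
        rw [h1] at h5
        cases h5
        exact ⟨_, h4, by omega⟩
  obtain ⟨hrl, hr1⟩ := List.getElem?_eq_some_iff.1 hr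
  have hposn : ∀ r', st[r']? = some w.length → (Encl m w).length + r' + 1 = st.length := by
    intro r' hr
    obtain ⟨hr, h1⟩ := List.getElem?_eq_some_iff.1 hr
    have : openHubs (state m (x (k + 1)).length) =
        (u :: st.take r') ++ w.length :: st.drop (r' + 1) := by
      rw [hs, ← h1, List.cons_append, ← List.drop_eq_getElem_cons, List.take_append_drop]; rfl
    obtain ⟨-, bt, h2⟩ := hub_of_openHubs this
    rw [Encl, encl_hub h2, List.length_drop]
    omega
  set D := (Encl m w).length with hD
  set R := 2 * dip m st.length + 2 with hR
  let V := Finset.Ioc (st.length - D) (st.length + 1 - e)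
  let T := V ∪ V.image (R - ·)
  have hT : T.card ≤ 2 * (D + 1 - e) := by
    have h1 : T.card ≤ V.card + (V.image (R - ·)).card := Finset.card_union_le _ _
    have h2 : (V.image (R - ·)).card ≤ V.card := Finset.card_image_le
    have h3 : V.card = st.length + 1 - e - (st.length - D) := by simp [V]
    omega
  have hmaps : ∀ i ∈ Finset.Ioc k n, (x i).length + j - (x (k + 1)).length ∈ T := by
    intro i hi
    simp only [Finset.mem_Ioc] at hi
    obtain ⟨j', h1, h2⟩ := hsame i hi.1 hi.2
    have hv := valid_state m (x i).length
    rw [h1] at hv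
    have hv4 := hv.2.2.2
    have e1 : (x i).length + j - (x (k + 1)).length = j' := by omega
    rw [e1]
    obtain ⟨-, u', st', bits', j1, h3, r', h4, h5⟩ := hz i hi.1 hi.2
    rw [h1] at h3
    cases h3
    have h6 := hposn r' h4
    have h7 := he i hi.2
    rw [Encl, h1] at h7
    simp only [encl, List.length_drop, List.length_cons] at h7
    have h8 : popped m st.length j' ∈ V := by
      have : popped m st.length j' ≤ st.length + 1 := by
        have := dip_le m st.length
        unfold popped; omega
      simp only [V, Finset.mem_Ioc]
      omega
    unfold wallLen at hv4
    unfold popped at h8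
    simp only [T, Finset.mem_union, Finset.mem_image]
    rcases le_total j' (2 * dip m st.length + 2 - j') with h9 | h9
    · left; rwa [min_eq_left h9] at h8
    · right
      rw [min_eq_right h9] at h8
      exact ⟨_, h8, by omega⟩
  have hfib : ∀ t ∈ T, ((Finset.Ioc k n).filter
      (fun i => (x i).length + j - (x (k + 1)).length = t)).card ≤ 2 := by
    intro t _
    by_contra hcard
    push Not at hcard
    obtain ⟨p, hp, q, hq, s, hs', hpq, hps, hqs⟩ := Finset.two_lt_card.1 hcard
    simp only [Finset.mem_filter, Finset.mem_Ioc] at hp hq hs'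
    have hlev : ∀ i, (k < i ∧ i ≤ n) ∧ (x i).length + j - (x (k + 1)).length = t →
        (x i).length + j = (x (k + 1)).length + t := by
      rintro i ⟨h1, h2⟩
      obtain ⟨j', -, h3⟩ := hsame i h1.1 h1.2
      omega
    have l1 := hlev p hp
    have l2 := hlev q hq
    have l3 := hlev s hs'
    have key : ∀ {p q r : ℕ}, k < p → p < q → q < r → r ≤ n →
        (x p).length = (x q).length → (x q).length = (x r).length → False := by
      intro p q r h1 h2 h3 h4 h5 h6
      refine level_twice (x := x) (a := k + 1) (b := n) ?_ ?_ h1 h2 h3 h4 h5 h6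
      · exact fun i _ hi j _ hj e => h.inj i hi j hj e
      · intro i hi hin
        rcases hl i hi hin with ⟨c, hc, -⟩ | ⟨c, hc, -⟩
        · exact Or.inl ⟨c, hc⟩
        · exact Or.inr ⟨c, hc⟩
    rcases lt_or_gt_of_ne hpq with o1 | o1 <;> rcases lt_or_gt_of_ne hps with o2 | o2 <;>
      rcases lt_or_gt_of_ne hqs with o3 | o3 <;> first
        | omega
        | exact key (p := p) (q := q) (r := s) (by omega) (by omega) (by omega) (by omega) (by omega) (by omega)
        | exact key (p := p) (q := s) (r := q) (by omega) (by omega) (by omega) (by omega) (by omega) (by omega)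
        | exact key (p := q) (q := p) (r := s) (by omega) (by omega) (by omega) (by omega) (by omega) (by omega)
        | exact key (p := q) (q := s) (r := p) (by omega) (by omega) (by omega) (by omega) (by omega) (by omega)
        | exact key (p := s) (q := p) (r := q) (by omega) (by omega) (by omega) (by omega) (by omega) (by omega)
        | exact key (p := s) (q := q) (r := p) (by omega) (by omega) (by omega) (by omega) (by omega) (by omega)
  have := Finset.card_le_mul_card_image_of_maps_to hmaps 2 hfib
  rw [Nat.card_Ioc] at this
  omega

end Walks

section Bounds
variable {m : ℕ} {S : Set (List Bool)} {x : ℕ → List Bool} {n : ℕ}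

theorem flat_from_min {e : ℕ} (h : IsWalk m S x n) (hf : IsFlat m x n)
    (hmin : ∀ i ≤ n, (x 0).length ≤ (x i).length) (he : ∀ i ≤ n, e ≤ (Encl m (x i)).length) :
    n ≤ bnd m e (depth (state m (x 0).length)) + 4 * (depth (state m (x 0).length) + 1 - e) ∧
      ∀ st bt, state m (x n).length = St.hub st bt → 1 ≤ e →
        depth (state m (x 0).length) + 1 - e ≤ 2 * (st.length + 1 - e) := by
  obtain ⟨k, hkn, hfw, hz, hl⟩ := exists_forward h hf hmin
  set D := depth (state m (x 0).length) with hD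
  have hok : ∀ i ≤ n, Ok m (state m (x i).length) := fun i hi => ok_state (h.alive i hi)
  have hfw' : ∀ i < k, Fwd m (state m (x i).length) (state m (x (i + 1)).length) := by
    intro i hi
    rcases hfw i hi with h1 | h1
    · exact h1.fwd (h.alive _ (by omega))
    · exact h1.fwd
  have hpot : ∀ i ≤ k, pot m e (state m (x i).length) + i ≤ pot m e (state m (x 0).length) ∧
      depth (state m (x i).length) ≤ D := by
    intro i
    induction i with
    | zero => intro _; exact ⟨le_rfl, le_rfl⟩
    | succ i ih =>
      intro hi
      obtain ⟨h1, h2⟩ := ih (by omega)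
      have h3 := pot_fwd (e := e) (hfw' i (by omega)) (hok _ (by omega)) (hok _ (by omega))
        (he _ (by omega)) (he _ (by omega))
      have h4 := depth_fwd (hfw' i (by omega))
      exact ⟨by omega, by omega⟩
  have hk := (hpot k le_rfl).1
  have hb := pot_le (hok 0 (by omega)) (he 0 (by omega))
  rw [← hD] at hb
  constructor
  · by_cases hlt : k < n
    · have h1 := zone_card h hz hl he
      obtain ⟨bt, h2⟩ := (hz n hlt le_rfl).hub.2
      have h3 := (hpot k le_rfl).2
      rw [h2] at h3
      simp only [depth] at h3
      omega
    · omega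
  · intro st bt hs he1
    by_cases hlt : k < n
    · exact absurd hs (hz n hlt le_rfl).not_hub
    have hkn : k = n := by omega
    subst hkn
    have hst := he k le_rfl
    rw [Encl, encl_hub hs] at hst
    by_cases hX : e + 1 ≤ D
    · have hD2 : D ≤ 2 ^ m := by
        have := hok 0 (by omega)
        generalize state m (x 0).length = s at this hD
        cases s with
        | hub st bits => rw [hD]; exact this.2
        | wall u st bits j => rw [hD]; exact this.2.1
        | done => exact this.elim
      obtain ⟨i, h1, h2, h3⟩ := exists_blocked he1 hD2 hX
      have habove : ∀ r ≤ k, Above m i (state m (x r).length) := by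
        intro r
        induction r with
        | zero => intro _; exact Or.inl h2
        | succ r ih =>
          intro hr
          exact above_fwd h1 (hfw' r (by omega)) (hok _ (by omega)) (he _ (by omega))
            (ih (by omega))
      have := habove k le_rfl
      rw [hs] at this
      simp only [Above, depth] at this
      omega
    · omega

theorem flat_bound {e : ℕ} (h : IsWalk m S x n) (hf : IsFlat m x n)
    (he : ∀ i ≤ n, e ≤ (Encl m (x i)).length) :
    n ≤ 44 * (m + 1) * (2 ^ m + 1 - e) ∧
      ∀ st bt, state m (x n).length = St.hub st bt → 1 ≤ e →
        n ≤ 88 * (m + 1) * (st.length + 1 - e) := by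
  obtain ⟨a, ha, hmin⟩ := Finset.exists_min_image (Finset.range (n + 1)) (fun i => (x i).length)
    ⟨0, by simp⟩
  simp only [Finset.mem_range] at ha hmin
  have han : a ≤ n := by omega
  obtain ⟨r1, r2⟩ := flat_from_min (e := e) (h.shift (a := a) (k := n - a) (by omega))
    (hf.shift (by omega)) (fun i hi => by simpa using hmin (a + i) (by omega))
    (fun i hi => he _ (by omega))
  obtain ⟨l1, -⟩ := flat_from_min (e := e) (h.reverse han le_rfl) (hf.reverse han le_rfl)
    (fun i hi => by simpa using hmin (a - i) (by omega)) (fun i hi => he _ (by omega))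
  simp only [Nat.add_zero, Nat.sub_zero, Nat.add_sub_cancel' han] at r1 r2 l1
  have hok := ok_state (h.alive a han)
  have hD := depth_ge_of_encl hok (he a han)
  have hb := bnd_le (m := m) hD
  have hD2 : depth (state m (x a).length) ≤ 2 ^ m := by
    generalize state m (x a).length = s at hok
    cases s with
    | hub st bits => exact hok.2
    | wall u st bits j => exact hok.2.1
    | done => exact hok.elim
  set X := depth (state m (x a).length) + 1 - e with hX
  have e1 : X ≤ (m + 1) * X := Nat.le_mul_of_pos_left _ (by omega)
  have e2 : 15 * (m + 1) * X = 15 * ((m + 1) * X) := by ring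
  have hn : n ≤ 44 * ((m + 1) * X) := by omega
  constructor
  · calc n ≤ 44 * ((m + 1) * X) := hn
      _ = 44 * (m + 1) * X := by ring
      _ ≤ _ := Nat.mul_le_mul_left _ (by omega)
  · intro st bt hs he1
    calc n ≤ 44 * ((m + 1) * X) := hn
      _ ≤ 44 * ((m + 1) * (2 * (st.length + 1 - e))) := by
          gcongr
          exact r2 st bt hs he1
      _ = _ := by ring

theorem in_after (h : IsWalk m S x n) {a b : ℕ} (hin : In m (x a) (x (a + 1))) (hab : a < b)
    (hb : b ≤ n) : In m (x a) (x b) :=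
  (h.in_iff (h.mem a (by omega)) hab hb fun i h1 h2 e => by
    have := h.inj _ (by omega) _ (by omega) e; omega).1 hin

theorem in_before (h : IsWalk m S x n) {a b : ℕ} (hin : In m (x (a + 1)) (x a)) (hab : b ≤ a)
    (ha : a < n) : In m (x (a + 1)) (x b) :=
  (h.in_iff (h.mem (a + 1) (by omega)) hab (by omega) fun i h1 h2 e => by
    have := h.inj _ (by omega) _ (by omega) e; omega).2 hin

theorem not_out_after (h : IsWalk m S x n) {a b : ℕ} (hin : In m (x a) (x (a + 1)))
    (hab : a ≤ b) (hb : b < n) : ¬ In m (x (b + 1)) (x b) := by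
  intro hout
  have h1 := (in_after h hin (b := b + 1) (by omega) (by omega)).length_lt
  have h2 := (in_before h hout hab hb).length_lt
  omega

theorem encl_length_of_in {z y : List Bool} (h : In m z y) :
    (Encl m z).length + 1 ≤ (Encl m y).length := by
  obtain ⟨l₁, l₂, h1⟩ := List.append_of_mem h.2
  obtain ⟨-, bt, h2⟩ := hub_of_encl h1
  rw [h1, Encl, encl_hub h2]
  simp

theorem entry_bound : ∀ (n : ℕ) {x : ℕ → List Bool}, IsWalk m S x n → 1 ≤ n →
    In m (x 0) (x 1) →
    n ≤ 89 * (m + 1) * (2 ^ m - (Encl m (x 0)).length) + 45 * (m + 1) * 2 ^ m := by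
  intro n
  induction n using Nat.strong_induction_on with
  | _ n ih =>
    intro x h hn hin
    classical
    set d := (Encl m (x 0)).length with hd
    have hP : 1 ≤ (m + 1) * 2 ^ m := Nat.mul_pos (by omega) (by positivity)
    have hencl : ∀ i, 1 ≤ i → i ≤ n → d + 1 ≤ (Encl m (x i)).length := fun i h1 h2 =>
      encl_length_of_in (in_after h hin h1 h2)
    by_cases hex : ∃ t, 1 ≤ t ∧ t < n ∧ In m (x t) (x (t + 1))
    · obtain ⟨ht1, htn, ht⟩ := Nat.find_spec hex
      have htmin : ∀ s, s < Nat.find hex → 1 ≤ s → ¬ In m (x s) (x (s + 1)) := by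
        intro s hs hs1 hc
        exact Nat.find_min hex hs ⟨hs1, by omega, hc⟩
      generalize Nat.find hex = t at ht1 htn ht htmin
      have h1 := (flat_bound (e := d + 1) (h.shift (a := 1) (k := t - 1) (by omega))
        (fun i hi => ⟨htmin (1 + i) (by omega) (by omega),
          not_out_after h hin (b := 1 + i) (by omega) (by omega)⟩)
        (fun i hi => hencl _ (by omega) (by omega))).2
      obtain ⟨bt, h2⟩ := state_hub_of_In ht
      have e1 : 1 + (t - 1) = t := by omega
      simp only [e1] at h1
      have h3 := h1 _ _ h2 (by omega)
      have h4 := ih (n - t) (by omega) (h.shift (a := t) (k := n - t) (by omega)) (by omega) ht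
      simp only [Nat.add_zero] at h4
      have h5 := hencl t ht1 (by omega)
      have h6 : (Encl m (x t)).length ≤ 2 ^ m := by
        have := ok_state (h.alive t (by omega))
        rw [h2] at this
        exact this.2
      set d' := (Encl m (x t)).length
      have e2 : 2 ^ m - d = (2 ^ m - d') + (d' - d) := by omega
      have e3 : d' - d ≤ (m + 1) * (d' - d) := Nat.le_mul_of_pos_left _ (by omega)
      have e4 : d' + 1 - (d + 1) = d' - d := by omega
      rw [e4] at h3
      rw [e2]
      have e5 : 89 * (m + 1) * ((2 ^ m - d') + (d' - d)) =
          89 * (m + 1) * (2 ^ m - d') + 88 * (m + 1) * (d' - d) + (m + 1) * (d' - d) := by ring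
      omega
    · push Not at hex
      have h1 := (flat_bound (e := d + 1) (h.shift (a := 1) (k := n - 1) (by omega))
        (fun i hi => ⟨hex (1 + i) (by omega) (by omega),
          not_out_after h hin (b := 1 + i) (by omega) (by omega)⟩)
        (fun i hi => hencl _ (by omega) (by omega))).1
      have h2 : 44 * (m + 1) * (2 ^ m + 1 - (d + 1)) ≤ 44 * (m + 1) * 2 ^ m :=
        Nat.mul_le_mul_left _ (by rw [Nat.add_sub_add_right]; exact Nat.sub_le _ _)
      have e1 : 45 * (m + 1) * 2 ^ m = 44 * (m + 1) * 2 ^ m + (m + 1) * 2 ^ m := by ring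
      omega

theorem exists_first_entry (h : IsWalk m S x n) :
    ∃ b ≤ n, (∀ i < b, ¬ In m (x i) (x (i + 1))) ∧ n - b ≤ 134 * (m + 1) * 2 ^ m := by
  classical
  by_cases hex : ∃ t, t < n ∧ In m (x t) (x (t + 1))
  · obtain ⟨htn, ht⟩ := Nat.find_spec hex
    have htmin : ∀ s, s < Nat.find hex → ¬ In m (x s) (x (s + 1)) := by
      intro s hs hc
      exact Nat.find_min hex hs ⟨by omega, hc⟩
    generalize Nat.find hex = t at htn ht htmin
    refine ⟨t, htn.le, htmin, ?_⟩
    have h1 := entry_bound _ (h.shift (a := t) (k := n - t) (by omega)) (by omega) ht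
    refine h1.trans ?_
    have : 89 * (m + 1) * (2 ^ m - (Encl m (x (t + 0))).length) ≤ 89 * (m + 1) * 2 ^ m :=
      Nat.mul_le_mul_left _ (Nat.sub_le _ _)
    calc _ ≤ 89 * (m + 1) * 2 ^ m + 45 * (m + 1) * 2 ^ m := by gcongr
      _ = _ := by ring
  · push Not at hex
    exact ⟨n, le_rfl, hex, by simp⟩

/-- The length of a walk is at most linear in `(m + 1) * 2 ^ m`. -/
theorem walk_bound (h : IsWalk m S x n) : n ≤ 356 * (m + 1) * 2 ^ m := by
  obtain ⟨b, hb, h1, h2⟩ := exists_first_entry h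
  obtain ⟨c, hc, h3, h4⟩ := exists_first_entry (h.reverse hb le_rfl)
  have hflat : IsFlat m (fun i => x (b - i)) c := by
    intro i hi
    refine ⟨h3 i hi, ?_⟩
    have e : b - (i + 1) + 1 = b - i := by omega
    have := h1 (b - (i + 1)) (by omega)
    rwa [e] at this
  have h5 := (flat_bound (e := 0) (h.reverse hb hc) hflat (fun i hi => Nat.zero_le _)).1
  have hP : m + 1 ≤ (m + 1) * 2 ^ m := Nat.le_mul_of_pos_right _ (by positivity)
  have e1 : 44 * (m + 1) * (2 ^ m + 1 - 0) = 44 * ((m + 1) * 2 ^ m) + 44 * (m + 1) := by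
    rw [Nat.sub_zero]; ring
  have e2 : 134 * (m + 1) * 2 ^ m = 134 * ((m + 1) * 2 ^ m) := by ring
  have e3 : 356 * (m + 1) * 2 ^ m = 356 * ((m + 1) * 2 ^ m) := by ring
  omega

end Bounds

theorem wall_run (m : ℕ) {p u : ℕ} {st : List ℕ} {bits : List Bool}
    (h : state m p = St.wall u st bits 1) :
    state m (p + (wallLen m st.length - 1)) = St.wall u st bits (wallLen m st.length) := by
  have key : ∀ j, j + 1 ≤ wallLen m st.length → state m (p + j) = St.wall u st bits (j + 1) := by
    intro j
    induction j with
    | zero => intro _; exact h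
    | succ j ih =>
      intro hj
      have hn : state m (p + j + 1) = nextState m (p + j) (state m (p + j)) := rfl
      rw [ih (by omega), nextState, if_pos (by omega)] at hn
      exact hn
  have h1 := wallLen_pos m st.length
  have := key (wallLen m st.length - 1) (by omega)
  rwa [Nat.sub_add_cancel h1] at this

theorem exists_wall_end (m : ℕ) : ∀ (k p : ℕ) (st : List ℕ) (bits : List Bool),
    st.length + k = 2 ^ m → state m p = St.hub st bits →
    ∃ q, p + 2 ^ k ≤ q ∧ state m q = St.wall p st bits (wallLen m st.length) := by
  intro k
  induction k with
  | zero =>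
    intro p st bits hk h
    have hn : state m (p + 1) = nextState m p (state m p) := rfl
    rw [h, nextState, if_neg (by omega)] at hn
    exact ⟨_, by rw [pow_zero]; omega, wall_run m hn⟩
  | succ k ih =>
    intro p st bits hk h
    have hn : state m (p + 1) = nextState m p (state m p) := rfl
    rw [h, nextState, if_pos (by omega)] at hn
    obtain ⟨q₁, h1, h2⟩ := ih _ _ _ (by simp only [List.length_cons]; omega) hn
    have hn₁ : state m (q₁ + 1) = nextState m q₁ (state m q₁) := rfl
    rw [h2, nextState, if_neg (by simp), afterWall] at hn₁
    obtain ⟨q₂, h3, h4⟩ := ih _ _ _ (by simp only [List.length_cons]; omega) hn₁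
    have hn₂ : state m (q₂ + 1) = nextState m q₂ (state m q₂) := rfl
    rw [h4, nextState, if_neg (by simp), afterWall] at hn₂
    refine ⟨_, ?_, wall_run m hn₂⟩
    rw [pow_succ]
    omega

/-- The sequence of states is long. -/
theorem exists_alive (m : ℕ) : ∃ N, 2 ^ 2 ^ m ≤ N ∧ ∀ p ≤ N, state m p ≠ St.done := by
  obtain ⟨q, h1, h2⟩ := exists_wall_end m (2 ^ m) 0 [] [] (by simp) rfl
  refine ⟨q, by simpa using h1, fun p hp hd => ?_⟩
  have : ∀ k, state m (p + k) = St.done := by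
    intro k
    induction k with
    | zero => exact hd
    | succ k ih =>
      have hn : state m (p + k + 1) = nextState m (p + k) (state m (p + k)) := rfl
      rw [ih] at hn
      exact hn
  have h3 := this (q - p)
  rw [Nat.add_sub_cancel' hp, h2] at h3
  cases h3

/-- The roles of the vertices that replace a node of the binary tree. -/
inductive Tag : Type
  | hub (c : ℕ) : Tag
  | ent (s j : ℕ) : Tag

/-- The edges of the graph, directed towards the vertices introduced earlier. -/
inductive Low (m : ℕ) : List Bool × Tag → List Bool × Tag → Prop
  | hub (x : List Bool) (c c' : ℕ) (h : c' < c) (h' : c < 3) : Low m (x, Tag.hub c) (x, Tag.hub c')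
  | chain (x : List Bool) (s j : ℕ) (h : j < 3) : Low m (x, Tag.ent s (j + 1)) (x, Tag.ent s j)
  | up (b : Bool) (x : List Bool) (s : ℕ) : Low m (b :: x, Tag.ent s 0) (x, Tag.hub (b.toNat + s))
  | top (x : List Bool) (s : ℕ) (h : s < 2) : Low m (x, Tag.ent s 3) (x, Tag.hub (2 * s))
  | tgt (x h : List Bool) (s j : ℕ) (hj : j < 3) (hl : Lb m x h) :
      Low m (x, Tag.ent s j) (h, Tag.hub j)

/-- A height function on the vertices. -/
def rk : List Bool × Tag → ℕ
  | (x, Tag.hub c) => 10 * x.length + min c 2 + 3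
  | (x, Tag.ent _ j) => 10 * x.length + (if j = 3 then 6 else j)

theorem Lb.length_lt {m : ℕ} {e h : List Bool} (hl : Lb m e h) : h.length < e.length := by
  obtain ⟨l₁, l₂, h1⟩ := List.append_of_mem (label_mem hl.2)
  exact (hub_of_openHubs h1).1

theorem Lb.unique {m : ℕ} {e h h' : List Bool} (hl : Lb m e h) (hl' : Lb m e h') : h = h' := by
  refine eq_of_suffix hl.1 hl'.1 ?_
  have := hl.2.symm.trans hl'.2
  simpa using this

theorem rk_lt {m : ℕ} {v u : List Bool × Tag} (h : Low m v u) : rk u < rk v := by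
  cases h with
  | hub x c c' h h' => simp only [rk]; omega
  | chain x s j h => simp only [rk]; split_ifs <;> omega
  | up b x s => simp only [rk, List.length_cons]; split_ifs <;> omega
  | top x s h => simp only [rk]; split_ifs <;> omega
  | tgt x h s j hj hl =>
    have := hl.length_lt
    simp only [rk]; split_ifs <;> omega

theorem low_two {m : ℕ} {v u₁ u₂ u₃ : List Bool × Tag} (h₁ : Low m v u₁) (h₂ : Low m v u₂)
    (h₃ : Low m v u₃) : u₁ = u₂ ∨ u₁ = u₃ ∨ u₂ = u₃ := by
  obtain ⟨x, t⟩ := v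
  cases t with
  | hub c =>
    cases h₁; cases h₂; cases h₃
    simp only [Prod.mk.injEq, Tag.hub.injEq, true_and]
    omega
  | ent s j =>
    have key : ∀ u, Low m (x, Tag.ent s j) u →
        (∃ h, Lb m x h ∧ u = (h, Tag.hub j)) ∨ (j = 0 ∧ ∃ b y, x = b :: y ∧
          u = (y, Tag.hub (b.toNat + s))) ∨ (1 ≤ j ∧ u = (x, Tag.ent s (j - 1))) ∨
          (j = 3 ∧ u = (x, Tag.hub (2 * s))) := by
      intro u hu
      cases hu with
      | chain _ _ j h => right; right; left; simp
      | up b x _ => right; left; exact ⟨rfl, _, _, rfl, rfl⟩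
      | top _ _ h => right; right; right; simp
      | tgt _ h _ _ hj hl => left; exact ⟨h, hl, rfl⟩
    have key3 : ∀ u, Low m (x, Tag.ent s 3) u →
        u = (x, Tag.ent s 2) ∨ u = (x, Tag.hub (2 * s)) := by
      intro u hu
      cases hu with
      | chain _ _ j h => left; rfl
      | top _ _ h => right; rfl
      | tgt _ h _ _ hj hl => omega
    have keyt : ∀ h h', Lb m x h → Lb m x h' → h = h' := fun h h' a b => a.unique b
    by_cases hj : j = 3
    · subst hj
      rcases key3 _ h₁ with rfl | rfl <;> rcases key3 _ h₂ with rfl | rfl <;>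
        rcases key3 _ h₃ with rfl | rfl <;> simp
    · rcases Nat.eq_zero_or_pos j with rfl | hpos
      · have key0 : ∀ u, Low m (x, Tag.ent s 0) u →
            (∃ h, Lb m x h ∧ u = (h, Tag.hub 0)) ∨ ∃ b y, x = b :: y ∧
              u = (y, Tag.hub (b.toNat + s)) := by
          intro u hu
          rcases key u hu with h | h | h | h
          · exact Or.inl h
          · exact Or.inr h.2
          · omega
          · omega
        have keyp : ∀ {b y b' y'}, x = b :: y → x = b' :: y' → b = b' ∧ y = y' := by
          rintro b y b' y' rfl h
          simpa using h
        have pair : ∀ {u u'}, (∃ h, Lb m x h ∧ u = (h, Tag.hub 0)) →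
            (∃ h, Lb m x h ∧ u' = (h, Tag.hub 0)) → u = u' := by
          rintro u u' ⟨h, a, rfl⟩ ⟨h', b, rfl⟩
          rw [keyt h h' a b]
        have pair' : ∀ {u u'}, (∃ b y, x = b :: y ∧ u = (y, Tag.hub (b.toNat + s))) →
            (∃ b y, x = b :: y ∧ u' = (y, Tag.hub (b.toNat + s))) → u = u' := by
          rintro u u' ⟨b, y, h, rfl⟩ ⟨b', y', h', rfl⟩
          obtain ⟨rfl, rfl⟩ := keyp h h'
          rfl
        rcases key0 _ h₁ with a | a <;> rcases key0 _ h₂ with b | b <;>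
          rcases key0 _ h₃ with c | c <;>
          first
            | exact Or.inl (pair a b)
            | exact Or.inl (pair' a b)
            | exact Or.inr (Or.inl (pair a c))
            | exact Or.inr (Or.inl (pair' a c))
            | exact Or.inr (Or.inr (pair b c))
            | exact Or.inr (Or.inr (pair' b c))
      · have keyj : ∀ u, Low m (x, Tag.ent s j) u →
            (∃ h, Lb m x h ∧ u = (h, Tag.hub j)) ∨ u = (x, Tag.ent s (j - 1)) := by
          intro u hu
          rcases key u hu with h | h | h | h
          · exact Or.inl h
          · omega
          · exact Or.inr h.2
          · omega
        have pair : ∀ {u u'}, (∃ h, Lb m x h ∧ u = (h, Tag.hub j)) →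
            (∃ h, Lb m x h ∧ u' = (h, Tag.hub j)) → u = u' := by
          rintro u u' ⟨h, a, rfl⟩ ⟨h', b, rfl⟩
          rw [keyt h h' a b]
        rcases keyj _ h₁ with a | a <;> rcases keyj _ h₂ with b | b <;>
          rcases keyj _ h₃ with c | c <;>
          first
            | exact Or.inl (pair a b)
            | exact Or.inl (a.trans b.symm)
            | exact Or.inr (Or.inl (pair a c))
            | exact Or.inr (Or.inl (a.trans c.symm))
            | exact Or.inr (Or.inr (pair b c))
            | exact Or.inr (Or.inr (b.trans c.symm))

/-- The graph in which every node of the infinite binary tree is replaced by a triangle and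
two chains of vertices. -/
def graph (m : ℕ) : SimpleGraph (List Bool × Tag) where
  Adj v u := Low m v u ∨ Low m u v
  symm := ⟨fun _ _ h => h.symm⟩
  loopless := ⟨fun v h => by rcases h with h | h <;> exact lt_irrefl _ (rk_lt h)⟩

theorem graph_ktt_free (m t : ℕ) (ht : 3 ≤ t) {a b : Fin t → List Bool × Tag}
    (ha : Function.Injective a) (hb : Function.Injective b)
    (hab : ∀ i j, (graph m).Adj (a i) (b j)) : False := by
  have key : ∀ {v : List Bool × Tag} {c : Fin t → List Bool × Tag}, Function.Injective c →
      (∀ j, (graph m).Adj v (c j)) → (∀ j, rk (c j) ≤ rk v) → False := by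
    intro v c hc h hr
    have hlow : ∀ j, Low m v (c j) := by
      intro j
      rcases h j with h1 | h1
      · exact h1
      · have := rk_lt h1
        have := hr j
        omega
    rcases low_two (hlow ⟨0, by omega⟩) (hlow ⟨1, by omega⟩) (hlow ⟨2, by omega⟩) with h | h | h <;>
      simpa using hc h
  have : Nonempty (Fin t) := ⟨⟨0, by omega⟩⟩
  obtain ⟨i, hi⟩ := Finite.exists_max (fun i => rk (a i))
  obtain ⟨j, hj⟩ := Finite.exists_max (fun i => rk (b i))
  rcases le_total (rk (a i)) (rk (b j)) with h | h
  · exact key ha (fun k => (hab k j).symm) (fun k => (hi k).trans h)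
  · exact key hb (hab i) (fun k => (hj k).trans h)

/-- The tags that occur in the finite graph. -/
def Tag.Good : Tag → Prop
  | Tag.hub c => c < 3
  | Tag.ent s j => s < 2 ∧ j < 4

/-- A detour from a parent node through its child `y`, following the list `p` below `y`. -/
def arm (p : List (List Bool × Tag)) (y : List Bool) : List (List Bool × Tag) :=
  (y, Tag.ent 0 0) :: (y, Tag.ent 0 1) :: (y, Tag.ent 0 2) :: (y, Tag.ent 0 3) ::
    (p ++ [(y, Tag.ent 1 3), (y, Tag.ent 1 2), (y, Tag.ent 1 1), (y, Tag.ent 1 0)])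

/-- A path through all the hub vertices at most `k` levels below `x`. -/
def longPath : ℕ → List Bool → List (List Bool × Tag)
  | 0, x => [(x, Tag.hub 0), (x, Tag.hub 1), (x, Tag.hub 2)]
  | k + 1, x => (x, Tag.hub 0) :: (arm (longPath k (false :: x)) (false :: x) ++
      (x, Tag.hub 1) :: (arm (longPath k (true :: x)) (true :: x) ++ [(x, Tag.hub 2)]))

theorem longPath_length (k : ℕ) (x : List Bool) : 2 ^ k ≤ (longPath k x).length := by
  induction k generalizing x with
  | zero => simp [longPath]
  | succ k ih =>
    have h1 := ih (false :: x)
    have h2 := ih (true :: x)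
    simp only [longPath, arm, List.length_cons, List.length_append, List.length_nil]
    rw [pow_succ]
    omega

theorem longPath_ends (k : ℕ) (x : List Bool) :
    (longPath k x).head? = some (x, Tag.hub 0) ∧
      (longPath k x).getLast? = some (x, Tag.hub 2) := by
  cases k with
  | zero => simp [longPath]
  | succ k => simp [longPath, List.getLast?_append, List.getLast?_cons]

theorem low_up (m : ℕ) (b : Bool) (x : List Bool) (s c : ℕ) (h : b.toNat + s = c) :
    Low m (b :: x, Tag.ent s 0) (x, Tag.hub c) := h ▸ Low.up b x s

theorem low_top (m : ℕ) (x : List Bool) (s c : ℕ) (hs : s < 2) (h : 2 * s = c) :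
    Low m (x, Tag.ent s 3) (x, Tag.hub c) := h ▸ Low.top x s hs

theorem longPath_chain (m k : ℕ) (x : List Bool) : (longPath k x).IsChain (graph m).Adj := by
  induction k generalizing x with
  | zero =>
    simp only [longPath, List.isChain_cons_cons, List.isChain_singleton, and_true]
    exact ⟨Or.inr (Low.hub x 1 0 (by omega) (by omega)),
      Or.inr (Low.hub x 2 1 (by omega) (by omega))⟩
  | succ k ih =>
    have harm : ∀ b, (arm (longPath k (b :: x)) (b :: x)).IsChain (graph m).Adj := by
      intro b
      have hc : ∀ s j, j < 3 →
          (graph m).Adj (b :: x, Tag.ent s (j + 1)) (b :: x, Tag.ent s j) := fun s j h =>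
        Or.inl (Low.chain _ s j h)
      obtain ⟨h1, h2⟩ := longPath_ends k (b :: x)
      simp only [arm, List.isChain_cons_cons]
      refine ⟨(hc 0 0 (by omega)).symm, (hc 0 1 (by omega)).symm, (hc 0 2 (by omega)).symm, ?_⟩
      rw [List.isChain_cons, List.isChain_append]
      refine ⟨?_, ih _, ?_, ?_⟩
      · simp only [List.head?_append, h1, Option.some_or, Option.mem_def, Option.some.injEq]
        rintro _ rfl
        exact Or.inl (low_top m _ 0 0 (by omega) rfl)
      · simp only [List.isChain_cons_cons, List.isChain_singleton, and_true]
        exact ⟨hc 1 2 (by omega), hc 1 1 (by omega), hc 1 0 (by omega)⟩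
      · simp only [h2, Option.mem_def, Option.some.injEq, List.head?_cons]
        rintro _ rfl _ rfl
        exact Or.inr (low_top m _ 1 2 (by omega) rfl)
    have hends : ∀ b, (arm (longPath k (b :: x)) (b :: x)).head? = some (b :: x, Tag.ent 0 0) ∧
        (arm (longPath k (b :: x)) (b :: x)).getLast? = some (b :: x, Tag.ent 1 0) := by
      intro b
      simp [arm, List.getLast?_append, List.getLast?_cons]
    simp only [longPath]
    rw [List.isChain_cons, List.isChain_append, List.isChain_cons, List.isChain_append]
    simp only [List.head?_append, hends, Option.some_or, Option.mem_def, Option.some.injEq,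
      List.head?_cons, List.isChain_singleton]
    refine ⟨?_, harm _, ⟨?_, harm _, trivial, ?_⟩, ?_⟩
    · rintro _ rfl
      exact Or.inr (low_up m _ _ 0 0 rfl)
    · rintro _ rfl
      exact Or.inr (low_up m _ _ 0 1 rfl)
    · rintro _ rfl _ rfl
      exact Or.inl (low_up m _ _ 1 2 rfl)
    · rintro _ rfl _ rfl
      exact Or.inl (low_up m _ _ 1 1 rfl)

theorem longPath_mem {k : ℕ} {x : List Bool} {v : List Bool × Tag} (h : v ∈ longPath k x) :
    x <:+ v.1 ∧ v.1.length ≤ x.length + k ∧ v.2.Good ∧ (v.1 = x → ∃ c, v.2 = Tag.hub c) := by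
  induction k generalizing x with
  | zero =>
    simp only [longPath, List.mem_cons, List.not_mem_nil, or_false] at h
    rcases h with rfl | rfl | rfl <;> simp [Tag.Good]
  | succ k ih =>
    have harm : ∀ b, v ∈ arm (longPath k (b :: x)) (b :: x) →
        b :: x <:+ v.1 ∧ v.1.length ≤ x.length + (k + 1) ∧ v.2.Good := by
      intro b hb
      simp only [arm, List.mem_cons, List.mem_append, List.not_mem_nil, or_false] at hb
      rcases hb with rfl | rfl | rfl | rfl | hb | rfl | rfl | rfl | rfl
      case inr.inr.inr.inr.inl =>
        obtain ⟨h1, h2, h3, -⟩ := ih hb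
        refine ⟨h1, ?_, h3⟩
        simp only [List.length_cons] at h2
        omega
      all_goals simp [Tag.Good]
    have harm' : ∀ b, v ∈ arm (longPath k (b :: x)) (b :: x) →
        x <:+ v.1 ∧ v.1.length ≤ x.length + (k + 1) ∧ v.2.Good ∧
          (v.1 = x → ∃ c, v.2 = Tag.hub c) := by
      intro b hb
      obtain ⟨h1, h2, h3⟩ := harm b hb
      refine ⟨(List.suffix_cons b x).trans h1, h2, h3, fun h => ?_⟩
      have := h1.length_le
      rw [h, List.length_cons] at this
      omega
    simp only [longPath, List.mem_cons, List.mem_append, List.not_mem_nil, or_false] at h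
    rcases h with rfl | h | rfl | h | rfl
    case inr.inl => exact harm' _ h
    case inr.inr.inr.inl => exact harm' _ h
    all_goals simp [Tag.Good]

theorem longPath_nodup (k : ℕ) (x : List Bool) : (longPath k x).Nodup := by
  induction k generalizing x with
  | zero => simp [longPath]
  | succ k ih =>
    have hmem : ∀ b v, v ∈ arm (longPath k (b :: x)) (b :: x) → b :: x <:+ v.1 := by
      intro b v hb
      simp only [arm, List.mem_cons, List.mem_append, List.not_mem_nil, or_false] at hb
      rcases hb with rfl | rfl | rfl | rfl | hb | rfl | rfl | rfl | rfl
      case inr.inr.inr.inr.inl => exact (longPath_mem hb).1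
      all_goals exact List.suffix_refl _
    have hx : ∀ b c, (x, Tag.hub c) ∉ arm (longPath k (b :: x)) (b :: x) := by
      intro b c h
      have := (hmem b _ h).length_le
      simp at this
    have harm : ∀ b, (arm (longPath k (b :: x)) (b :: x)).Nodup := by
      intro b
      have hent : ∀ s j, (b :: x, Tag.ent s j) ∉ longPath k (b :: x) := by
        intro s j h
        obtain ⟨c, h⟩ := (longPath_mem h).2.2.2 rfl
        cases h
      simp [arm, List.nodup_append, ih, hent]
      rintro y t h
      refine ⟨?_, ?_, ?_, ?_⟩ <;> rintro rfl rfl <;> exact hent _ _ h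
    have hdisj : ∀ v, v ∈ arm (longPath k (false :: x)) (false :: x) →
        v ∉ arm (longPath k (true :: x)) (true :: x) := by
      intro v h1 h2
      have := eq_of_suffix (hmem _ v h1) (hmem _ v h2) (by simp)
      simp at this
    simp only [longPath, List.nodup_cons, List.nodup_append, List.mem_append, List.mem_cons]
    simp only [hx, harm]
    simp only [List.not_mem_nil, not_false_eq_true, List.nodup_nil, or_false, true_and, and_true,
      Prod.mk.injEq, Tag.hub.injEq, OfNat.zero_ne_ofNat, zero_ne_one, and_false,
      forall_eq, OfNat.one_ne_ofNat]
    refine ⟨fun v h => ?_, fun v h => ?_⟩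
    · rintro rfl
      exact hx _ _ h
    · rintro u (rfl | h' | rfl) rfl
      · exact hx _ _ h
      · exact hdisj _ h h'
      · exact hx _ _ h

theorem adj_hub_hub {m : ℕ} {x y : List Bool} {c c' : ℕ}
    (h : (graph m).Adj (x, Tag.hub c) (y, Tag.hub c')) : x = y := by
  rcases h with h | h <;> cases h <;> rfl

theorem adj_hub {m : ℕ} (x : List Bool) {c c' : ℕ} (hne : c ≠ c') (hc : c < 3) (hc' : c' < 3) :
    (graph m).Adj (x, Tag.hub c) (x, Tag.hub c') := by
  rcases lt_or_gt_of_ne hne with h | h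
  · exact Or.inr (Low.hub x _ _ h hc')
  · exact Or.inl (Low.hub x _ _ h hc)

theorem adj_ent_ent {m : ℕ} {x y : List Bool} {s s' j j' : ℕ}
    (h : (graph m).Adj (x, Tag.ent s j) (y, Tag.ent s' j')) :
    y = x ∧ s' = s ∧ (j' = j + 1 ∨ j' + 1 = j) := by
  rcases h with h | h <;> cases h <;> simp

theorem adj_ent_hub {m : ℕ} {x y : List Bool} {s j c : ℕ}
    (h : (graph m).Adj (y, Tag.ent s j) (x, Tag.hub c)) :
    (j = 0 ∧ ∃ b, y = b :: x) ∨ (j = 3 ∧ x = y) ∨ Lb m y x := by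
  rcases h with h | h
  · cases h with
    | up b x s => exact Or.inl ⟨rfl, b, rfl⟩
    | top x s h => exact Or.inr (Or.inl ⟨rfl, rfl⟩)
    | tgt x h s j hj hl => exact Or.inr (Or.inr hl)
  · cases h

/-- The sequence `q` traces an induced path on `M` vertices. -/
structure IsTrace (m : ℕ) (q : ℕ → List Bool × Tag) (M : ℕ) : Prop where
  inj : ∀ i < M, ∀ j < M, q i = q j → i = j
  adj : ∀ i < M, ∀ j < M, ((graph m).Adj (q i) (q j) ↔ (i + 1 = j ∨ j + 1 = i))
  good : ∀ i < M, (q i).2.Good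
  alive : ∀ i < M, state m (q i).1.length ≠ St.done

/-- The nodes of the binary tree whose triangles are visited. -/
def nodes (q : ℕ → List Bool × Tag) (M : ℕ) : Set (List Bool) :=
  {x | ∃ i < M, ∃ c, q i = (x, Tag.hub c)}

section Trace
variable {m : ℕ} {q : ℕ → List Bool × Tag} {M : ℕ}

theorem IsTrace.run (h : IsTrace m q M) (a : ℕ) : ∀ r, a + r < M →
    (∀ t ≤ r, ∀ x c, q (a + t) ≠ (x, Tag.hub c)) →
    ∃ y s, ∃ g : ℕ → ℕ, (∀ t ≤ r, q (a + t) = (y, Tag.ent s (g t))) ∧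
      ((∀ t ≤ r, g t = g 0 + t) ∨ (∀ t ≤ r, g t + t = g 0)) := by
  have hent : ∀ i, (∀ x c, q i ≠ (x, Tag.hub c)) → ∃ y s j, q i = (y, Tag.ent s j) := by
    intro i hi
    rcases e : q i with ⟨y, c | ⟨s, j⟩⟩
    · exact absurd e (hi _ _)
    · exact ⟨_, _, _, rfl⟩
  intro r
  induction r with
  | zero =>
    intro _ he
    obtain ⟨y, s, j, e⟩ := hent (a + 0) (he 0 le_rfl)
    refine ⟨y, s, fun _ => j, fun t ht => ?_, Or.inl fun t ht => ?_⟩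
    · rw [Nat.le_zero.1 ht, e]
    · rw [Nat.le_zero.1 ht]; rfl
  | succ r ih =>
    intro hr he
    obtain ⟨y, s, g, hg, hmon⟩ := ih (by omega) fun t ht => he t (by omega)
    obtain ⟨y', s', j, e⟩ := hent (a + (r + 1)) (he _ le_rfl)
    have hadj := (h.adj (a + r) (by omega) (a + (r + 1)) hr).2 (Or.inl rfl)
    rw [hg r le_rfl, e] at hadj
    obtain ⟨rfl, rfl, hj⟩ := adj_ent_ent hadj
    have hback : ∀ t, t < r → g t ≠ j := by
      rintro t ht rfl
      have := h.inj (a + t) (by omega) (a + (r + 1)) hr ((hg t ht.le).trans e.symm)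
      omega
    obtain ⟨G, hG, hG'⟩ : ∃ G : ℕ → ℕ, (∀ t ≤ r, G t = g t) ∧ G (r + 1) = j :=
      ⟨fun t => if t ≤ r then g t else j, fun t ht => if_pos ht, if_neg (by omega)⟩
    have hle : ∀ {t}, t ≤ r + 1 → t ≤ r ∨ t = r + 1 := by omega
    have hG0 := hG 0 (Nat.zero_le _)
    refine ⟨y', s', G, fun t ht => ?_, ?_⟩
    · rcases hle ht with ht | rfl
      · rw [hG t ht]; exact hg t ht
      · rw [hG']; exact e
    · have hprev : 1 ≤ r → g (r - 1) ≠ j := fun h1 => hback _ (by omega)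
      rcases hmon with hm | hm <;> rcases hj with hj | hj
      · left
        intro t ht
        have := hm r le_rfl
        rcases hle ht with ht | rfl
        · have := hm t ht; have := hG t ht; omega
        · omega
      · obtain rfl : r = 0 := by
          have := hm r le_rfl
          have := hm (r - 1) (by omega)
          omega
        right
        intro t ht
        rcases hle ht with ht | rfl
        · have := hm t ht; have := hG t ht; omega
        · omega
      · obtain rfl : r = 0 := by
          have := hm r le_rfl
          have := hm (r - 1) (by omega)
          omega
        left
        intro t ht
        rcases hle ht with ht | rfl
        · have := hm t ht; have := hG t ht; omega
        · omega
      · right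
        intro t ht
        have := hm r le_rfl
        rcases hle ht with ht | rfl
        · have := hm t ht; have := hG t ht; omega
        · omega

theorem IsTrace.run_le (h : IsTrace m q M) {a r : ℕ} (hr : a + r < M)
    (he : ∀ t ≤ r, ∀ x c, q (a + t) ≠ (x, Tag.hub c)) : r ≤ 3 := by
  obtain ⟨y, s, g, hg, hmon⟩ := h.run a r hr he
  have h1 := h.good (a + r) hr
  have h2 := h.good (a + 0) (by omega)
  rw [hg r le_rfl] at h1
  rw [hg 0 (Nat.zero_le _)] at h2
  have h3 := h1.2
  have h4 := h2.2
  rcases hmon with hm | hm <;> have := hm r le_rfl <;> omega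

theorem IsTrace.step_child (h : IsTrace m q M) {x : List Bool} {b : Bool} {s : ℕ}
    (hs : ∀ j < 3, ∃ i < M, q i = (b :: x, Tag.ent s j) ∧ ∀ k < M, ∀ z c, q k = (z, Tag.hub c) →
      (i + 1 = k ∨ k + 1 = i) → z = x ∨ z = b :: x) :
    Step m (nodes q M) x (b :: x) := by
  by_cases hl : ∃ z, Lb m (b :: x) z ∧ z ∈ nodes q M
  · obtain ⟨z, hz, k, hk, c, hc⟩ := hl
    have hg := h.good k hk
    rw [hc] at hg
    obtain ⟨i, hi, hq, hnb⟩ := hs c hg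
    have hadj : (graph m).Adj (q i) (q k) := by
      rw [hq, hc]
      exact Or.inl (Low.tgt _ _ _ _ hg hz)
    rcases hnb k hk z c hc ((h.adj i hi k hk).1 hadj) with rfl | rfl
    · exact Or.inr (Or.inr (Or.inl ⟨_, hz, Or.inl rfl⟩))
    · exact absurd hz.length_lt (lt_irrefl _)
  · exact Or.inl ⟨b, rfl, fun z hz hm => hl ⟨z, hz, hm⟩⟩

theorem IsTrace.step_hubs (h : IsTrace m q M) {a r : ℕ} {x x' : List Bool} {c c' : ℕ}
    (hr : a + 1 + r + 1 < M) (ha : q a = (x, Tag.hub c)) (hb : q (a + 1 + r + 1) = (x', Tag.hub c'))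
    (he : ∀ t ≤ r, ∀ z d, q (a + 1 + t) ≠ (z, Tag.hub d)) (hne : x ≠ x') :
    Step m (nodes q M) x x' := by
  obtain ⟨y, s, g, hg, hmon⟩ := h.run (a + 1) r (by omega) he
  have h1 := (h.adj (a + 1 + 0) (by omega) a (by omega)).2 (Or.inr rfl)
  rw [hg 0 (Nat.zero_le _), ha] at h1
  have h2 := (h.adj (a + 1 + r) (by omega) (a + 1 + r + 1) hr).2 (Or.inl rfl)
  rw [hg r le_rfl, hb] at h2
  have hnb : ∀ t ≤ r, ∀ k < M, ∀ z d, q k = (z, Tag.hub d) →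
      (a + 1 + t + 1 = k ∨ k + 1 = a + 1 + t) → z = x ∨ z = x' := by
    intro t ht k hk z d hq hk'
    by_cases hk1 : k = a
    · subst hk1
      rw [ha] at hq
      exact Or.inl (congrArg Prod.fst hq).symm
    · by_cases hk2 : k = a + 1 + r + 1
      · subst hk2
        rw [hb] at hq
        exact Or.inr (congrArg Prod.fst hq).symm
      · have := he (k - (a + 1)) (by omega) z d
        rw [show a + 1 + (k - (a + 1)) = k by omega] at this
        exact absurd hq this
  have hcov : ∀ t ≤ r, ∀ j, g t = j → ∃ i < M, q i = (y, Tag.ent s j) ∧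
      ∀ k < M, ∀ z d, q k = (z, Tag.hub d) → (i + 1 = k ∨ k + 1 = i) → z = x ∨ z = x' := by
    rintro t ht _ rfl
    exact ⟨a + 1 + t, by omega, hg t ht, hnb t ht⟩
  rcases adj_ent_hub h1 with ⟨j0, b, e⟩ | ⟨j0, e⟩ | hl <;>
    rcases adj_ent_hub h2 with ⟨j1, b', e'⟩ | ⟨j1, e'⟩ | hl'
  · rw [e] at e'
    exact absurd (List.cons.inj e').2 hne
  · subst e'
    subst e
    refine h.step_child (s := s) fun j hj => ?_
    refine hcov j ?_ j ?_
    · rcases hmon with hm | hm <;> have := hm r le_rfl <;> omega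
    · have hrj : j ≤ r := by rcases hmon with hm | hm <;> have := hm r le_rfl <;> omega
      rcases hmon with hm | hm
      · have := hm j hrj; omega
      · have := hm r le_rfl; omega
  · exact Or.inr (Or.inr (Or.inr ⟨y, hl', Or.inr ⟨b, e⟩⟩))
  · subst e
    subst e'
    refine (h.step_child (s := s) fun j hj => ?_).symm
    have hr3 : r = 3 := by rcases hmon with hm | hm <;> have := hm r le_rfl <;> omega
    obtain ⟨i, hi, hq, hn⟩ := hcov (3 - j) (by omega) j (by
      rcases hmon with hm | hm
      · have := hm r le_rfl; omega
      · have := hm (3 - j) (by omega); omega)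
    exact ⟨i, hi, hq, fun k hk z d hz hk' => (hn k hk z d hz hk').symm⟩
  · exact absurd (e.trans e'.symm) hne
  · exact Or.inr (Or.inr (Or.inr ⟨y, hl', Or.inl e⟩))
  · exact Or.inr (Or.inr (Or.inl ⟨y, hl, Or.inr ⟨b', e'⟩⟩))
  · exact Or.inr (Or.inr (Or.inl ⟨y, hl, Or.inl e'⟩))
  · exact absurd (hl.unique hl') hne

theorem IsTrace.hub_succ (h : IsTrace m q M) {a k : ℕ} {x : List Bool} {c d : ℕ} (hak : a < k)
    (hk : k < M) (ha : q a = (x, Tag.hub c)) (hq : q k = (x, Tag.hub d)) : k = a + 1 := by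
  have h1 := h.good a (by omega)
  have h2 := h.good k hk
  rw [ha] at h1
  rw [hq] at h2
  have hne : c ≠ d := by
    rintro rfl
    have := h.inj a (by omega) k hk (ha.trans hq.symm)
    omega
  have hadj : (graph m).Adj (q a) (q k) := by
    rw [ha, hq]; exact adj_hub x hne h1 h2
  have := (h.adj a (by omega) k hk).1 hadj
  omega

theorem IsTrace.exists_last (h : IsTrace m q M) {a : ℕ} {x : List Bool} {c : ℕ} (haM : a < M)
    (ha : q a = (x, Tag.hub c)) : ∃ a' c', a ≤ a' ∧ a' ≤ a + 1 ∧ a' < M ∧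
      q a' = (x, Tag.hub c') ∧ ∀ k, a' < k → k < M → ∀ d, q k ≠ (x, Tag.hub d) := by
  by_cases h1 : a + 1 < M ∧ ∃ d, q (a + 1) = (x, Tag.hub d)
  · obtain ⟨h1, d, hd⟩ := h1
    refine ⟨a + 1, d, by omega, le_rfl, h1, hd, fun k hk hkM d' hq => ?_⟩
    have := h.hub_succ (by omega) hkM ha hq
    omega
  · refine ⟨a, c, le_rfl, by omega, haM, ha, fun k hk hkM d' hq => h1 ?_⟩
    obtain rfl := h.hub_succ hk hkM ha hq
    exact ⟨hkM, d', hq⟩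

theorem IsTrace.exists_list (h : IsTrace m q M) (a : ℕ) (x : List Bool) (c : ℕ) (haM : a < M)
    (ha : q a = (x, Tag.hub c)) : ∃ L : List (List Bool), L.Nodup ∧
      L.IsChain (Step m (nodes q M)) ∧ L.head? = some x ∧
      (∀ z ∈ L, ∃ i < M, a ≤ i ∧ ∃ d, q i = (z, Tag.hub d)) ∧ M - a ≤ 6 * L.length := by
  obtain ⟨k, hk⟩ : ∃ k, M - a = k := ⟨_, rfl⟩
  induction k using Nat.strong_induction_on generalizing a x c with
  | _ k ih =>
    subst hk
    obtain ⟨a', c', h1, h2, h3, h4, h5⟩ := h.exists_last haM ha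
    by_cases hex : ∃ b, a' < b ∧ b < M ∧ ∃ z d, q b = (z, Tag.hub d)
    · classical
      obtain ⟨hb1, hb2, z, d, hb⟩ := Nat.find_spec hex
      have hmin : ∀ i, a' < i → i < Nat.find hex → ∀ z d, q i ≠ (z, Tag.hub d) :=
        fun i hi hi' z d hq => Nat.find_min hex hi' ⟨hi, hi'.trans hb2, z, d, hq⟩
      generalize Nat.find hex = b at hb1 hb2 hb hmin
      have hne : x ≠ z := by
        rintro rfl
        exact h5 b hb1 hb2 d hb
      have hb' : a' + 1 ≠ b := by
        rintro rfl
        have := (h.adj a' h3 (a' + 1) hb2).2 (Or.inl rfl)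
        rw [h4, hb] at this
        exact hne (adj_hub_hub this)
      obtain ⟨r, rfl⟩ : ∃ r, b = a' + 1 + r + 1 := ⟨b - (a' + 1) - 1, by omega⟩
      have he : ∀ t ≤ r, ∀ z d, q (a' + 1 + t) ≠ (z, Tag.hub d) :=
        fun t ht => hmin _ (by omega) (by omega)
      have hr := h.run_le (by omega) he
      have hstep := h.step_hubs hb2 h4 hb he hne
      obtain ⟨L, l1, l2, l3, l4, l5⟩ := ih _ (by omega) _ z d hb2 hb rfl
      refine ⟨x :: L, ?_, ?_, rfl, ?_, ?_⟩
      · refine List.nodup_cons.2 ⟨fun hx => ?_, l1⟩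
        obtain ⟨i, hi, hi', d', hq⟩ := l4 x hx
        exact h5 i (by omega) hi d' hq
      · refine List.isChain_cons.2 ⟨?_, l2⟩
        simp only [l3, Option.mem_def, Option.some.injEq]
        rintro _ rfl
        exact hstep
      · intro y hy
        rcases List.mem_cons.1 hy with rfl | hy
        · exact ⟨a, haM, le_rfl, c, ha⟩
        · obtain ⟨i, hi, hi', hd⟩ := l4 y hy
          exact ⟨i, hi, by omega, hd⟩
      · rw [List.length_cons]
        omega
    · refine ⟨[x], by simp, by simp, rfl, ?_, ?_⟩
      · intro y hy
        rw [List.mem_singleton.1 hy]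
        exact ⟨a, haM, le_rfl, c, ha⟩
      · by_contra hlt
        rw [List.length_singleton] at hlt
        have := h.run_le (a := a' + 1) (r := 4) (by omega) fun t ht z d hq =>
          hex ⟨a' + 1 + t, by omega, by omega, z, d, hq⟩
        omega

/-- Induced paths are short. -/
theorem IsTrace.length_le (h : IsTrace m q M) : M ≤ 6 * (356 * (m + 1) * 2 ^ m) + 10 := by
  by_cases hex : ∃ a, a < M ∧ ∃ x c, q a = (x, Tag.hub c)
  · classical
    obtain ⟨ha, x, c, hq⟩ := Nat.find_spec hex
    have hmin : ∀ i, i < Nat.find hex → ∀ z d, q i ≠ (z, Tag.hub d) :=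
      fun i hi z d hq => Nat.find_min hex hi ⟨hi.trans ha, z, d, hq⟩
    generalize Nat.find hex = a at ha hq hmin
    have ha4 : a ≤ 4 := by
      by_contra hlt
      have := h.run_le (a := 0) (r := 4) (by omega) fun t ht => hmin _ (by omega)
      omega
    obtain ⟨L, l1, l2, l3, l4, l5⟩ := h.exists_list a x c ha hq
    have hget : ∀ i (hi : i ≤ L.length - 1), L.getD i [] = L[i]'(by omega) :=
      fun i hi => List.getD_eq_getElem _ _ _
    have hw : IsWalk m (nodes q M) (fun i => L.getD i []) (L.length - 1) := by
      have hm : ∀ i ≤ L.length - 1, ∃ k < M, a ≤ k ∧ ∃ d, q k = (L.getD i [], Tag.hub d) := by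
        intro i hi
        rw [hget i hi]
        exact l4 _ (List.getElem_mem _)
      refine ⟨fun i hi => ?_, fun i hi => ?_, fun i hi j hj e => ?_, fun i hi => ?_⟩
      · obtain ⟨k, hk, -, d, hd⟩ := hm i hi
        exact ⟨k, hk, d, hd⟩
      · obtain ⟨k, hk, -, d, hd⟩ := hm i hi
        have := h.alive k hk
        rwa [hd] at this
      · simp only [hget i hi, hget j hj] at e
        exact (l1.getElem_inj_iff).1 e
      · simp only [hget i hi.le, hget (i + 1) hi]
        exact l2.getElem i (by omega)
    have := walk_bound hw
    omega
  · by_contra hlt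
    have := h.run_le (a := 0) (r := 4) (by omega) fun t ht z d hq =>
      hex ⟨0 + t, by omega, z, d, hq⟩
    omega

end Trace

theorem finite_good : {t : Tag | t.Good}.Finite := by
  refine (((Set.finite_lt_nat 3).image Tag.hub).union
    (((Set.finite_lt_nat 2).prod (Set.finite_lt_nat 4)).image fun p => Tag.ent p.1 p.2)).subset ?_
  rintro (c | ⟨s, j⟩) h
  · exact Or.inl ⟨c, h, rfl⟩
  · exact Or.inr ⟨(s, j), h, rfl⟩

theorem exists_graph (m t : ℕ) (ht : 3 ≤ t) : ∃ (V : Type) (_ : Fintype V) (G : SimpleGraph V)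
    (n : ℕ), ¬ ContainsKtt G t ∧ HasPathOn G n ∧ 2 ^ 2 ^ 2 ^ m ≤ n ∧
      ∀ M, HasInducedPathOn G M → M ≤ 6 * (356 * (m + 1) * 2 ^ m) + 10 := by
  obtain ⟨N, hN, halive⟩ := exists_alive m
  have hfin : {v : List Bool × Tag | v.1.length ≤ N ∧ v.2.Good}.Finite :=
    ((List.finite_length_le Bool N).prod finite_good).subset fun v hv => hv
  refine ⟨{v : List Bool × Tag | v.1.length ≤ N ∧ v.2.Good}, hfin.fintype,
    (graph m).comap Subtype.val, (longPath N []).length, ?_, ?_, ?_, ?_⟩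
  · rintro ⟨a, b, ha, hb, -, hab⟩
    exact graph_ktt_free m t ht (Subtype.val_injective.comp ha) (Subtype.val_injective.comp hb) hab
  · refine ⟨fun i => ⟨(longPath N [])[i], ?_⟩, fun i j hij => ?_, fun i hi => ?_⟩
    · obtain ⟨-, h1, h2, -⟩ := longPath_mem (List.getElem_mem (l := longPath N []) i.2)
      exact ⟨by simpa using h1, h2⟩
    · exact Fin.ext ((longPath_nodup N []).getElem_inj_iff.1 (congrArg Subtype.val hij))
    · exact (longPath_chain m N []).getElem i hi
  · exact (Nat.pow_le_pow_right (by omega) hN).trans (longPath_length N [])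
  · rintro M ⟨p, hp, hadj⟩
    let q : ℕ → List Bool × Tag := fun i => if h : i < M then (p ⟨i, h⟩).1 else ([], Tag.hub 0)
    have hq : ∀ i (h : i < M), q i = (p ⟨i, h⟩).1 := fun i h => dif_pos h
    refine IsTrace.length_le (q := q) ⟨fun i hi j hj e => ?_, fun i hi j hj => ?_,
      fun i hi => ?_, fun i hi => ?_⟩
    · rw [hq i hi, hq j hj] at e
      exact congrArg Fin.val (hp (Subtype.ext e))
    · rw [hq i hi, hq j hj]
      exact hadj ⟨i, hi⟩ ⟨j, hj⟩
    · rw [hq i hi]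
      exact (p ⟨i, hi⟩).2.2
    · rw [hq i hi]
      exact halive _ (p ⟨i, hi⟩).2.1

theorem le_logb_of_pow_le {k : ℕ} {x : ℝ} (h : (2 : ℝ) ^ k ≤ x) : (k : ℝ) ≤ Real.logb 2 x := by
  rw [Real.le_logb_iff_rpow_le (by norm_num) (lt_of_lt_of_le (by positivity) h), Real.rpow_natCast]
  exact h

end KttPath

theorem ktt_free_lower_bound_upper_limit (t : ℕ) (ht : 3 ≤ t) :
    ∃ c : ℝ, 0 < c ∧
      ∀ f : ℕ → ℕ,
        (∀ (V : Type) [Fintype V] (G : SimpleGraph V) (n : ℕ),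
            ¬ ContainsKtt G t → HasPathOn G n → ∃ m : ℕ, f n ≤ m ∧ HasInducedPathOn G m) →
        ∀ N : ℕ, ∃ n : ℕ, N ≤ n ∧
          (f n : ℝ) ≤ c * Real.logb 2 (Real.logb 2 n) *
            Real.logb 2 (Real.logb 2 (Real.logb 2 n)) := by

  refine ⟨4282, by norm_num, fun f hf N => ?_⟩
  obtain ⟨V, _, G, n, h1, h2, h3, h4⟩ := KttPath.exists_graph (N + 1) t ht
  refine ⟨n, ?_, ?_⟩
  · have a₁ : N + 1 < 2 ^ (N + 1) := Nat.lt_two_pow_self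
    have a₂ : 2 ^ (N + 1) < 2 ^ 2 ^ (N + 1) := Nat.lt_two_pow_self
    have a₃ : 2 ^ 2 ^ (N + 1) < 2 ^ 2 ^ 2 ^ (N + 1) := Nat.lt_two_pow_self
    omega
  obtain ⟨M, hM, hind⟩ := hf V G n h1 h2
  have hle := hM.trans (h4 M hind)
  have l₁ : ((2 ^ 2 ^ (N + 1) : ℕ) : ℝ) ≤ Real.logb 2 n :=
    KttPath.le_logb_of_pow_le (by exact_mod_cast h3)
  have l₂ : ((2 ^ (N + 1) : ℕ) : ℝ) ≤ Real.logb 2 (Real.logb 2 n) :=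
    KttPath.le_logb_of_pow_le (by exact_mod_cast l₁)
  have l₃ : ((N + 1 : ℕ) : ℝ) ≤ Real.logb 2 (Real.logb 2 (Real.logb 2 n)) :=
    KttPath.le_logb_of_pow_le (by exact_mod_cast l₂)
  have hnat : f n ≤ 4282 * 2 ^ (N + 1) * (N + 1) := by
    have hp : 1 ≤ 2 ^ (N + 1) := Nat.one_le_two_pow
    generalize 2 ^ (N + 1) = P at hle hp
    nlinarith [Nat.zero_le (N * P)]
  calc (f n : ℝ) ≤ ((4282 * 2 ^ (N + 1) * (N + 1) : ℕ) : ℝ) := by exact_mod_cast hnat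
    _ = 4282 * ((2 ^ (N + 1) : ℕ) : ℝ) * ((N + 1 : ℕ) : ℝ) := by push_cast; ring
    _ ≤ _ := by
      have := (Nat.cast_nonneg _).trans l₂
      gcongr
end

section
/- For every integer k ≥ 1, every k-degenerate finite simple graph that contains a path on n vertices, where n ≥ 4, contains an induced path on at least (log₂ log₂ n)/(log₂ (k+1)) vertices. -/
/-- In a digraph with out-degrees at most `c` all of whose vertices are reachable from `r`, the
breadth-first search from `r` has some depth `d` such that there are at most
`1 + c + ⋯ + c ^ d` vertices, and a shortest path of length `d` has no forward shortcut. -/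
theorem exists_geodesic_of_outDegree_le {α : Type*} [Fintype α] (R : α → α → Prop) (r : α)
    (c : ℕ) (hreach : ∀ x, Relation.ReflTransGen R r x)
    (hdeg : ∀ x, {y | R x y}.ncard ≤ c) :
    ∃ (d : ℕ) (s : ℕ → α), Fintype.card α ≤ ∑ i ∈ Finset.range (d + 1), c ^ i ∧
      (∀ i < d, R (s i) (s (i + 1))) ∧
      ∀ i j, i + 1 < j → j ≤ d → ¬ R (s i) (s j) := by
  classical
  let out : α → Finset α := fun x => Finset.univ.filter (R x)
  have hout : ∀ x, (out x).card ≤ c := by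
    intro x
    have h := hdeg x
    rwa [Set.ncard_eq_toFinset_card', Set.toFinset_ofPred] at h
  obtain ⟨L, hL0, hLs⟩ : ∃ L : ℕ → Finset α, L 0 = {r} ∧ ∀ d, L (d + 1) = (L d).biUnion out :=
    ⟨fun d => (fun B => B.biUnion out)^[d] {r}, rfl, fun d => Function.iterate_succ_apply' _ d _⟩
  have hcard : ∀ d, (L d).card ≤ c ^ d := by
    intro d
    induction d with
    | zero => simp [hL0]
    | succ d ih =>
      rw [hLs, pow_succ]
      exact (Finset.card_biUnion_le_card_mul _ _ c fun x _ => hout x).trans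
        (Nat.mul_le_mul_right c ih)
  have hex : ∀ x, ∃ d, x ∈ L d := by
    intro x
    induction hreach x with
    | refl => exact ⟨0, by simp [hL0]⟩
    | tail _ hyz ih =>
      obtain ⟨d, hd⟩ := ih
      exact ⟨d + 1, by rw [hLs]; exact Finset.mem_biUnion.2 ⟨_, hd, by simpa [out] using hyz⟩⟩
  let f : α → ℕ := fun x => Nat.find (hex x)
  have hf : ∀ x, x ∈ L (f x) := fun x => Nat.find_spec (hex x)
  have hfle : ∀ x d, x ∈ L d → f x ≤ d := fun x d h => Nat.find_min' (hex x) h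
  have hstep : ∀ x y, R x y → f y ≤ f x + 1 := by
    intro x y h
    apply hfle
    rw [hLs]
    exact Finset.mem_biUnion.2 ⟨x, hf x, by simpa [out] using h⟩
  have hpath : ∀ d x, f x = d → ∃ s : ℕ → α, s d = x ∧ (∀ i ≤ d, f (s i) = i) ∧
      ∀ i < d, R (s i) (s (i + 1)) := by
    intro d
    induction d with
    | zero =>
      intro x hx
      exact ⟨fun _ => x, rfl, fun i hi => by simp [hx]; omega, fun i hi => by omega⟩
    | succ d ih =>
      intro x hx
      have h1 := hf x
      rw [hx, hLs] at h1
      obtain ⟨y, hy, hyx⟩ := Finset.mem_biUnion.1 h1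
      have hR : R y x := by simpa [out] using hyx
      have hfy : f y = d := by
        have h2 := hfle y d hy
        have h3 := hstep y x hR
        omega
      obtain ⟨s, hs, hsf, hsR⟩ := ih y hfy
      refine ⟨fun i => if i ≤ d then s i else x, by simp, ?_, ?_⟩
      · intro i hi
        by_cases h : i ≤ d
        · simp [h, hsf i h]
        · simp only [h, if_false]
          omega
      · intro i hi
        by_cases h : i + 1 ≤ d
        · have h' : i ≤ d := by omega
          simpa [h, h'] using hsR i (by omega)
        · have h' : i = d := by omega
          subst h'
          simpa [hs] using hR
  obtain ⟨t, -, ht⟩ := Finset.exists_max_image Finset.univ f ⟨r, Finset.mem_univ r⟩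
  obtain ⟨s, -, hsf, hsR⟩ := hpath (f t) t rfl
  refine ⟨f t, s, ?_, hsR, ?_⟩
  · have hcov : (Finset.univ : Finset α) ⊆ (Finset.range (f t + 1)).biUnion L := by
      intro x _
      exact Finset.mem_biUnion.2 ⟨f x, by simpa [Nat.lt_succ_iff] using ht x (Finset.mem_univ x), hf x⟩
    calc Fintype.card α ≤ ((Finset.range (f t + 1)).biUnion L).card := Finset.card_le_card hcov
      _ ≤ ∑ i ∈ Finset.range (f t + 1), (L i).card := Finset.card_biUnion_le
      _ ≤ _ := Finset.sum_le_sum fun i _ => hcard i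
  · intro i j hij hj hR
    have h := hstep _ _ hR
    rw [hsf i (by omega), hsf j hj] at h
    omega

/-- A finite `k`-degenerate graph has an orientation with all out-degrees at most `k`. -/
theorem Degenerate.exists_orientation {V : Type*} [Finite V] {k : ℕ} {G : SimpleGraph V}
    (hG : Degenerate k G) :
    ∃ O : V → V → Prop, (∀ u v, O u v → G.Adj u v) ∧
      (∀ u v, G.Adj u v → O u v ∨ O v u) ∧ ∀ v, {u | O v u}.ncard ≤ k := by
  classical
  cases nonempty_fintype V
  suffices h : ∀ S : Finset V, ∃ O : V → V → Prop, (∀ u v, O u v → u ∈ S ∧ G.Adj u v) ∧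
      (∀ u ∈ S, ∀ v ∈ S, G.Adj u v → O u v ∨ O v u) ∧ ∀ v, {u | O v u}.ncard ≤ k by
    obtain ⟨O, h1, h2, h3⟩ := h Finset.univ
    exact ⟨O, fun u v h => (h1 u v h).2, fun u v => h2 u (Finset.mem_univ u) v (Finset.mem_univ v), h3⟩
  intro S
  induction S using Finset.strongInduction with
  | H S ih =>
    rcases S.eq_empty_or_nonempty with rfl | hS
    · exact ⟨fun _ _ => False, by simp, by simp, by simp⟩
    obtain ⟨v, hv, hvk⟩ := hG (S : Set V) S.finite_toSet hS
    have hvS : v ∈ S := hv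
    obtain ⟨O, h1, h2, h3⟩ := ih (S.erase v) (Finset.erase_ssubset hvS)
    refine ⟨fun x y => if x = v then y ∈ S ∧ G.Adj v y else O x y, ?_, ?_, ?_⟩
    · intro x y hxy
      by_cases hx : x = v
      · subst hx
        simp only [if_true] at hxy
        exact ⟨hvS, hxy.2⟩
      · simp only [hx, if_false] at hxy
        exact ⟨Finset.mem_of_mem_erase (h1 x y hxy).1, (h1 x y hxy).2⟩
    · intro x hx y hy hxy
      by_cases hxv : x = v
      · left
        subst hxv
        simp [hy, hxy]
      · by_cases hyv : y = v
        · right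
          subst hyv
          simp [hx, hxy.symm]
        · simpa [hxv, hyv] using
            h2 x (Finset.mem_erase.2 ⟨hxv, hx⟩) y (Finset.mem_erase.2 ⟨hyv, hy⟩) hxy
    · intro x
      by_cases hx : x = v
      · simpa [hx] using hvk
      · simpa [hx] using h3 x

/-- If a set of indices is sent injectively into a set of size at most `k`, except for at most
one index, then it has at most `k + 1` elements. -/
theorem ncard_le_succ_of_forall_eq_or_mem {ι V : Type*} [Finite ι] [Finite V] {p : ι → V}
    (hp : Function.Injective p) {A : Set ι} {B : Set V} {k : ℕ} (hB : B.ncard ≤ k)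
    (hA : ∃ a, ∀ j ∈ A, j = a ∨ p j ∈ B) : A.ncard ≤ k + 1 := by
  obtain ⟨a, ha⟩ := hA
  have hsub : A ⊆ insert a (p ⁻¹' B) := fun j hj => ha j hj
  have hpre : (p ⁻¹' B).ncard ≤ B.ncard := by
    rw [← Set.ncard_image_of_injective _ hp]
    exact Set.ncard_le_ncard (Set.image_preimage_subset p B) (Set.toFinite _)
  have h1 := Set.ncard_le_ncard hsub (Set.toFinite _)
  have h2 := Set.ncard_insert_le a (p ⁻¹' B)
  omega

/-- A path `p` on `n` vertices in a graph oriented with out-degrees at most `k` can be shortened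
to a path on `a` vertices in which every non-consecutive edge is oriented backwards, where
`n ≤ 1 + (k + 1) + ⋯ + (k + 1) ^ (a - 1)`. -/
theorem HasPathOn.exists_backward_path {V : Type*} [Finite V] {G : SimpleGraph V} {k n : ℕ}
    (hn : 0 < n) (hpath : HasPathOn G n) {O : V → V → Prop}
    (hOG : ∀ u v, O u v → G.Adj u v) (hO : ∀ v, {u | O v u}.ncard ≤ k) :
    ∃ (d : ℕ) (q : Fin (d + 1) → V), n ≤ ∑ i ∈ Finset.range (d + 1), (k + 1) ^ i ∧
      Function.Injective q ∧
      (∀ i j : Fin (d + 1), i.val + 1 = j.val → G.Adj (q i) (q j)) ∧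
      ∀ i j : Fin (d + 1), i.val + 1 < j.val → ¬ O (q i) (q j) := by
  obtain ⟨p, hp, hadj⟩ := hpath
  let R : Fin n → Fin n → Prop := fun i j => i < j ∧ (i.val + 1 = j.val ∨ O (p i) (p j))
  have hRadj : ∀ i j, R i j → G.Adj (p i) (p j) := by
    rintro i j ⟨-, h | h⟩
    · have h' : i.val + 1 < n := h ▸ j.2
      have e : j = ⟨i.val + 1, h'⟩ := Fin.ext h.symm
      rw [e]
      exact hadj i.val h'
    · exact hOG _ _ h
  have hreach : ∀ x, Relation.ReflTransGen R ⟨0, hn⟩ x := by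
    rintro ⟨x, hx⟩
    induction x with
    | zero => exact .refl
    | succ x ih =>
      exact (ih (by omega)).tail ⟨by simp [Fin.lt_def], Or.inl rfl⟩
  have hdeg : ∀ i, {j | R i j}.ncard ≤ k + 1 := by
    intro i
    refine ncard_le_succ_of_forall_eq_or_mem hp (hO (p i)) ?_
    by_cases h : i.val + 1 < n
    · exact ⟨⟨i.val + 1, h⟩, fun j hj => hj.2.imp (fun e => Fin.ext e.symm) id⟩
    · exact ⟨i, fun j hj => absurd hj.1 (by have := j.2; rw [Fin.lt_def]; omega)⟩
  obtain ⟨d, s, hcard, hsR, hs⟩ := exists_geodesic_of_outDegree_le R ⟨0, hn⟩ (k + 1) hreach hdeg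
  have hmono : StrictMono fun i : Fin (d + 1) => s i.val :=
    Fin.strictMono_iff_lt_succ.2 fun i => (hsR i.val i.2).1
  refine ⟨d, fun i => p (s i.val), by simpa using hcard, hp.comp hmono.injective, ?_, ?_⟩
  · intro i j hij
    have h := hsR i.val (by omega)
    rw [hij] at h
    exact hRadj _ _ h
  · intro i j hij h
    exact hs i.val j.val hij (by omega) ⟨hmono (by rw [Fin.lt_def]; omega), Or.inr h⟩

/-- In a graph oriented with out-degrees at most `k`, a path on `d + 1` vertices all of whose
non-consecutive edges are oriented backwards yields an induced path on `m` vertices with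
`d + 1 ≤ 1 + (k + 1) + ⋯ + (k + 1) ^ (m - 1)`. -/
theorem exists_inducedPath_of_backward_path {V : Type*} [Finite V] {G : SimpleGraph V} {k d : ℕ}
    {O : V → V → Prop} (hGO : ∀ u v, G.Adj u v → O u v ∨ O v u)
    (hO : ∀ v, {u | O v u}.ncard ≤ k) (q : Fin (d + 1) → V) (hq : Function.Injective q)
    (hadj : ∀ i j : Fin (d + 1), i.val + 1 = j.val → G.Adj (q i) (q j))
    (hback : ∀ i j : Fin (d + 1), i.val + 1 < j.val → ¬ O (q i) (q j)) :
    ∃ m, HasInducedPathOn G m ∧ d + 1 ≤ ∑ i ∈ Finset.range m, (k + 1) ^ i := by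
  let R : Fin (d + 1) → Fin (d + 1) → Prop := fun i j => j < i ∧ G.Adj (q i) (q j)
  have hreach : ∀ x, Relation.ReflTransGen R (Fin.last d) x := by
    intro x
    induction x using Fin.reverseInduction with
    | last => exact .refl
    | cast i ih => exact ih.tail ⟨Fin.castSucc_lt_succ, (hadj _ _ (by simp)).symm⟩
  have hdeg : ∀ i, {j | R i j}.ncard ≤ k + 1 := by
    intro i
    refine ncard_le_succ_of_forall_eq_or_mem hq (hO (q i)) ⟨⟨i.val - 1, by omega⟩, ?_⟩
    rintro j ⟨hji, hA⟩
    rw [Fin.lt_def] at hji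
    by_cases h : j.val + 1 = i.val
    · left
      ext
      simp only
      omega
    · exact Or.inr ((hGO _ _ hA).resolve_right (hback j i (by omega)))
  obtain ⟨e, s, hcard, hsR, hs⟩ :=
    exists_geodesic_of_outDegree_le R (Fin.last d) (k + 1) hreach hdeg
  have hanti : StrictAnti fun i : Fin (e + 1) => s i.val :=
    Fin.strictAnti_iff_succ_lt.2 fun i => (hsR i.val i.2).1
  have key : ∀ i j : Fin (e + 1), i < j → (G.Adj (q (s i)) (q (s j)) ↔ i.val + 1 = j.val) := by
    intro i j hij
    refine ⟨fun h => ?_, fun h => ?_⟩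
    · by_contra hne
      rw [Fin.lt_def] at hij
      exact hs i.val j.val (by omega) (by omega) ⟨hanti hij, h⟩
    · have h' := hsR i.val (by omega)
      rw [h] at h'
      exact h'.2
  refine ⟨e + 1, ⟨fun i => q (s i.val), hq.comp hanti.injective, fun i j => ?_⟩,
    by simpa using hcard⟩
  rcases lt_trichotomy i j with h | h | h
  · rw [key i j h]
    rw [Fin.lt_def] at h
    omega
  · subst h
    simp
  · rw [G.adj_comm, key j i h]
    rw [Fin.lt_def] at h
    omega

theorem sum_range_pow_succ_mul_add_one (k m : ℕ) :
    (∑ i ∈ Finset.range m, (k + 1) ^ i) * k + 1 = (k + 1) ^ m := by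
  induction m with
  | zero => simp
  | succ m ih =>
    rw [Finset.sum_range_succ, add_mul, pow_succ]
    linarith

theorem degenerate_long_induced_path (k : ℕ) (hk : 1 ≤ k)
    (V : Type) [Fintype V] (G : SimpleGraph V) (n : ℕ) (hn : 4 ≤ n)
    (hdeg : Degenerate k G) (hpath : HasPathOn G n) :
    ∃ m : ℕ, HasInducedPathOn G m ∧
      Real.logb 2 (Real.logb 2 n) / Real.logb 2 ((k : ℝ) + 1) ≤ (m : ℝ) := by
  obtain ⟨O, hOG, hGO, hO⟩ := hdeg.exists_orientation
  obtain ⟨d, q, hnd, hq, hadj, hback⟩ := hpath.exists_backward_path (by omega) hOG hO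
  obtain ⟨m, hm, hdm⟩ := exists_inducedPath_of_backward_path hGO hO q hq hadj hback
  refine ⟨m, hm, ?_⟩
  have h1 := sum_range_pow_succ_mul_add_one k (d + 1)
  have h2 := sum_range_pow_succ_mul_add_one k m
  have hnpow : n ≤ 2 ^ ((k + 1) ^ m) := by
    calc n ≤ (k + 1) ^ (d + 1) := by nlinarith
      _ ≤ (2 ^ k) ^ (d + 1) := Nat.pow_le_pow_left Nat.lt_two_pow_self _
      _ = 2 ^ (k * (d + 1)) := (pow_mul _ _ _).symm
      _ ≤ _ := Nat.pow_le_pow_right (by norm_num) (by nlinarith)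
  have hn' : (4 : ℝ) ≤ n := by exact_mod_cast hn
  have hlog : Real.logb 2 n ≤ ((k : ℝ) + 1) ^ m := by
    rw [Real.logb_le_iff_le_rpow (by norm_num) (by linarith)]
    have h : (n : ℝ) ≤ 2 ^ ((k + 1) ^ m) := by exact_mod_cast hnpow
    rw [← Real.rpow_natCast] at h
    exact_mod_cast h
  have hpos : 0 < Real.logb 2 n := Real.logb_pos (by norm_num) (by linarith)
  have hk' : (1 : ℝ) ≤ k := by exact_mod_cast hk
  rw [div_le_iff₀ (Real.logb_pos (by norm_num) (by linarith)), ← Real.logb_pow]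
  exact Real.logb_le_logb_of_le (by norm_num) hpos hlog
end

section
/- For every integer t ≥ 1 and every integer M, there exists an integer N such that every finite simple graph that contains no subgraph isomorphic to the complete bipartite graph K_{t,t} and contains a path on at least N vertices also contains an induced path on at least M vertices. -/
theorem HasInducedPathOn.of_induce {V : Type*} {G : SimpleGraph V} {s : Set V} {n : ℕ}
    (h : HasInducedPathOn (G.induce s) n) : HasInducedPathOn G n := by
  obtain ⟨p, hp, hadj⟩ := h
  exact ⟨fun i => (p i : V), fun i j hij => hp (Subtype.ext hij), fun i j => hadj i j⟩

/-- A shortest walk is an induced path. -/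
theorem hasInducedPathOn_dist_add_one {V : Type*} {G : SimpleGraph V} {u v : V}
    (h : G.Reachable u v) : HasInducedPathOn G (G.dist u v + 1) := by
  obtain ⟨w, hw⟩ := h.exists_walk_length_eq_dist
  have hdist : ∀ i ≤ w.length, G.dist u (w.getVert i) = i := by
    intro i hi
    have h₁ : G.dist u (w.getVert i) ≤ i := by
      have := SimpleGraph.dist_le (w.take i)
      rw [SimpleGraph.Walk.take_length] at this
      omega
    have h₂ : G.dist (w.getVert i) v ≤ w.length - i := by
      have := SimpleGraph.dist_le (w.drop i)
      rwa [SimpleGraph.Walk.drop_length] at this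
    have h₃ := (w.take i).reachable.dist_triangle_left v
    omega
  refine ⟨fun i => w.getVert i, fun i j hij => ?_, fun i j => ⟨fun hij => ?_, ?_⟩⟩
  · have hi := hdist i (by omega)
    have hj := hdist j (by omega)
    simp only at hij
    rw [hij] at hi
    exact Fin.ext (hi.symm.trans hj)
  · have hi := hdist i (by omega)
    have hj := hdist j (by omega)
    have hne : i.val ≠ j.val := fun he => hij.ne (by simp only [he])
    have h₁ := (w.take i).reachable.dist_triangle_left (w.getVert j)
    have h₂ := (w.take j).reachable.dist_triangle_left (w.getVert i)
    rw [SimpleGraph.dist_eq_one_iff_adj.2 hij] at h₁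
    rw [SimpleGraph.dist_eq_one_iff_adj.2 hij.symm] at h₂
    omega
  · rintro (hij | hij)
    · simp only [← hij]
      exact w.adj_getVert_succ (by omega)
    · simp only [← hij]
      exact (w.adj_getVert_succ (by omega)).symm

theorem reachable_induce_of_chain {V : Type*} {G : SimpleGraph V} {s : Set V} {f : ℕ → V} {n : ℕ}
    (hs : ∀ i ≤ n, f i ∈ s) (hf : ∀ i < n, f i = f (i + 1) ∨ G.Adj (f i) (f (i + 1))) :
    (G.induce s).Reachable ⟨f 0, hs 0 n.zero_le⟩ ⟨f n, hs n le_rfl⟩ := by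
  induction n with
  | zero => exact SimpleGraph.Reachable.refl _
  | succ n ih =>
    refine (ih (fun i hi => hs i (by omega)) (fun i hi => hf i (by omega))).trans ?_
    rcases hf n (by omega) with h | h
    · simp only [h]
      exact SimpleGraph.Reachable.refl _
    · exact SimpleGraph.Adj.reachable (G := G.induce s) h

/-- If a graph on `ℕ` traversed by `0, 1, 2, …` has no induced path on `M` or more vertices, then
any `a < b` are joined inside the interval `[a, b]` by a walk with at most `M` steps. -/
theorem exists_short_walks {G : SimpleGraph ℕ} (hG : ∀ i, G.Adj i (i + 1)) {M : ℕ}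
    (hM : ∀ m, M ≤ m → ¬ HasInducedPathOn G m) :
    ∃ p : ℕ → ℕ → ℕ → ℕ, ∀ a b, a < b → p a b 0 = a ∧ p a b M = b ∧
      (∀ i, a ≤ p a b i ∧ p a b i ≤ b) ∧
      ∀ i, p a b i = p a b (i + 1) ∨ G.Adj (p a b i) (p a b (i + 1)) := by
  have key : ∀ a b, ∃ p : ℕ → ℕ, a < b → p 0 = a ∧ p M = b ∧
      (∀ i, a ≤ p i ∧ p i ≤ b) ∧ ∀ i, p i = p (i + 1) ∨ G.Adj (p i) (p (i + 1)) := by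
    intro a b
    by_cases hab : a < b
    swap
    · exact ⟨id, fun h => absurd h hab⟩
    have hr : (G.induce (Set.Icc a b)).Reachable ⟨a, by simp [hab.le]⟩ ⟨b, by simp [hab.le]⟩ := by
      have := reachable_induce_of_chain (G := G) (s := Set.Icc a b) (f := fun i => a + i)
        (n := b - a) (fun i hi => ⟨by omega, by omega⟩) (fun i _ => Or.inr (hG _))
      simpa only [Nat.add_sub_of_le hab.le, Nat.add_zero] using this
    obtain ⟨w, hw⟩ := hr.exists_walk_length_eq_dist
    have hlen : w.length + 1 < M := by
      by_contra hcon
      refine hM _ (not_lt.1 hcon) ?_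
      rw [hw]
      exact (hasInducedPathOn_dist_add_one hr).of_induce
    refine ⟨fun i => w.getVert i, fun _ => ⟨by simp, ?_, fun i => (w.getVert i).2, fun i => ?_⟩⟩
    · simp only [w.getVert_of_length_le (show w.length ≤ M by omega)]
    · rcases lt_or_ge i w.length with hi | hi
      · exact Or.inr (w.adj_getVert_succ hi)
      · left
        simp only [w.getVert_of_length_le hi, w.getVert_of_length_le (show w.length ≤ i + 1 by omega)]
  choose p hp using key
  exact ⟨p, hp⟩

/-- A relation holding for generic quadruples with respect to a nonprincipal ultrafilter on `ℕ`
holds for all increasing quadruples in arbitrarily large finite sets. -/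
theorem exists_finset_of_eventually {U : Filter ℕ} [U.NeBot] (hU : U ≤ Filter.atTop)
    {Q : ℕ → ℕ → ℕ → ℕ → Prop} (hQ : ∀ᶠ a in U, ∀ᶠ b in U, ∀ᶠ c in U, ∀ᶠ d in U, Q a b c d)
    (n : ℕ) : ∃ x : Fin n → ℕ, StrictMono x ∧
      ∀ i j k l, i < j → j < k → k < l → Q (x i) (x j) (x k) (x l) := by
  have key : ∃ S : Finset ℕ, S.card = n ∧
      (∀ a ∈ S, ∀ᶠ b in U, ∀ᶠ c in U, ∀ᶠ d in U, Q a b c d) ∧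
      (∀ a ∈ S, ∀ b ∈ S, a < b → ∀ᶠ c in U, ∀ᶠ d in U, Q a b c d) ∧
      (∀ a ∈ S, ∀ b ∈ S, ∀ c ∈ S, a < b → b < c → ∀ᶠ d in U, Q a b c d) ∧
      (∀ a ∈ S, ∀ b ∈ S, ∀ c ∈ S, ∀ d ∈ S, a < b → b < c → c < d → Q a b c d) := by
    induction n with
    | zero => exact ⟨∅, by simp⟩
    | succ n ih =>
      obtain ⟨S, hS, h₁, h₂, h₃, h₄⟩ := ih
      have e₀ : ∀ᶠ x in U, ∀ a ∈ S, a < x :=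
        (Filter.eventually_all_finset S).2 fun a _ => hU (Filter.eventually_gt_atTop a)
      have e₂ : ∀ᶠ x in U, ∀ a ∈ S, ∀ᶠ c in U, ∀ᶠ d in U, Q a x c d :=
        (Filter.eventually_all_finset S).2 h₁
      have e₃ : ∀ᶠ x in U, ∀ a ∈ S, ∀ b ∈ S, a < b → ∀ᶠ d in U, Q a b x d := by
        simpa only [Filter.eventually_all_finset, Filter.eventually_imp_distrib_left] using h₂
      have e₄ : ∀ᶠ x in U, ∀ a ∈ S, ∀ b ∈ S, ∀ c ∈ S, a < b → b < c → Q a b c x := by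
        simpa only [Filter.eventually_all_finset, Filter.eventually_imp_distrib_left] using h₃
      obtain ⟨x, x₀, x₁, x₂, x₃, x₄⟩ := (e₀.and (hQ.and (e₂.and (e₃.and e₄)))).exists
      have hx : x ∉ S := fun h => lt_irrefl _ (x₀ x h)
      refine ⟨insert x S, by rw [Finset.card_insert_of_notMem hx, hS], ?_, ?_, ?_, ?_⟩ <;>
        simp only [Finset.mem_insert]
      · rintro a (rfl | ha)
        exacts [x₁, h₁ a ha]
      · rintro a (rfl | ha) b (rfl | hb) hab
        · omega
        · have := x₀ b hb; omega
        · exact x₂ a ha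
        · exact h₂ a ha b hb hab
      · rintro a ha b hb c (rfl | hc) hab hbc
        · exact x₃ a (ha.resolve_left (by omega)) b (hb.resolve_left (by omega)) hab
        · have := x₀ c hc
          exact h₃ a (ha.resolve_left (by omega)) b (hb.resolve_left (by omega)) c hc hab hbc
      · rintro a ha b hb c hc d (rfl | hd) hab hbc hcd
        · exact x₄ a (ha.resolve_left (by omega)) b (hb.resolve_left (by omega)) c
            (hc.resolve_left (by omega)) hab hbc
        · have := x₀ d hd
          exact h₄ a (ha.resolve_left (by omega)) b (hb.resolve_left (by omega)) c
            (hc.resolve_left (by omega)) d hd hab hbc hcd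
  obtain ⟨S, hS, -, -, -, h⟩ := key
  have hmono := (S.orderEmbOfFin hS).strictMono
  exact ⟨S.orderEmbOfFin hS, hmono, fun i j k l hij hjk hkl =>
    h _ (S.orderEmbOfFin_mem hS i) _ (S.orderEmbOfFin_mem hS j) _ (S.orderEmbOfFin_mem hS k) _
      (S.orderEmbOfFin_mem hS l) (hmono hij) (hmono hjk) (hmono hkl)⟩

/-- Vertices chosen from intervals `[a, b]` cannot be generically adjacent in a graph without
`K_{t,t}`. -/
theorem eventually_not_adj {G : SimpleGraph ℕ} {t : ℕ} (hG : ¬ ContainsKtt G t)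
    {U : Ultrafilter ℕ} (hU : (U : Filter ℕ) ≤ Filter.atTop) {f g : ℕ → ℕ → ℕ}
    (hf : ∀ a b, a < b → a ≤ f a b ∧ f a b ≤ b) (hg : ∀ a b, a < b → a ≤ g a b ∧ g a b ≤ b) :
    ∀ᶠ a in (U : Filter ℕ), ∀ᶠ b in (U : Filter ℕ), ∀ᶠ c in (U : Filter ℕ),
      ∀ᶠ d in (U : Filter ℕ), ¬ G.Adj (f a b) (g c d) := by
  by_contra hcon
  simp only [Ultrafilter.eventually_not, not_not] at hcon
  obtain ⟨x, hx, hadj⟩ := exists_finset_of_eventually hU hcon (4 * t)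
  have inj : ∀ (h : ℕ → ℕ → ℕ) (_ : ∀ a b, a < b → a ≤ h a b ∧ h a b ≤ b)
      (y z : Fin t → Fin (4 * t)) (_ : ∀ i, y i < z i) (_ : ∀ i j, i < j → z i < y j),
      Function.Injective fun i => h (x (y i)) (x (z i)) := by
    intro h hh y z hyz hzy
    refine StrictMono.injective fun i j hij => ?_
    exact ((hh _ _ (hx (hyz i))).2.trans_lt (hx (hzy i j hij))).trans_le (hh _ _ (hx (hyz j))).1
  have hA : ∀ i j : Fin t,
      G.Adj (f (x ⟨2 * i, by omega⟩) (x ⟨2 * i + 1, by omega⟩))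
        (g (x ⟨2 * t + 2 * j, by omega⟩) (x ⟨2 * t + 2 * j + 1, by omega⟩)) := fun i j =>
    hadj _ _ _ _ (Fin.mk_lt_mk.2 (by omega)) (Fin.mk_lt_mk.2 (by omega))
      (Fin.mk_lt_mk.2 (by omega))
  exact hG ⟨_, _,
    inj f hf (fun i => ⟨2 * i, by omega⟩) (fun i => ⟨2 * i + 1, by omega⟩)
      (fun i => Fin.mk_lt_mk.2 (by omega)) (fun i j hij => Fin.mk_lt_mk.2 (by omega)),
    inj g hg (fun i => ⟨2 * t + 2 * i, by omega⟩) (fun i => ⟨2 * t + 2 * i + 1, by omega⟩)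
      (fun i => Fin.mk_lt_mk.2 (by omega)) (fun i j hij => Fin.mk_lt_mk.2 (by omega)),
    fun i j => (hA i j).ne, hA⟩

/-- A potential increasing by at most one along edges bounds the length of walks from below. -/
theorem le_add_length_of_adj_le {V : Type*} {G : SimpleGraph V} {f : V → ℕ}
    (hf : ∀ u v, G.Adj u v → f v ≤ f u + 1) {u v : V} (w : G.Walk u v) :
    f v ≤ f u + w.length := by
  induction w with
  | nil => simp
  | cons h w ih =>
    have := hf _ _ h
    rw [SimpleGraph.Walk.length_cons]
    omega

/-- The infinite version: a graph on `ℕ` without `K_{t,t}` in which `0, 1, 2, …` is a path has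
arbitrarily long finite induced paths. -/
theorem exists_hasInducedPathOn_of_adj_succ {G : SimpleGraph ℕ} {t : ℕ} (hK : ¬ ContainsKtt G t)
    (hG : ∀ i, G.Adj i (i + 1)) (M : ℕ) : ∃ m, M ≤ m ∧ HasInducedPathOn G m := by
  by_contra! hM
  obtain ⟨p, hp⟩ := exists_short_walks hG hM
  have hU : (Filter.hyperfilter ℕ : Filter ℕ) ≤ Filter.atTop := Nat.hyperfilter_le_atTop
  have hQ : ∀ᶠ a in (Filter.hyperfilter ℕ : Filter ℕ), ∀ᶠ b in (Filter.hyperfilter ℕ : Filter ℕ),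
      ∀ᶠ c in (Filter.hyperfilter ℕ : Filter ℕ), ∀ᶠ d in (Filter.hyperfilter ℕ : Filter ℕ),
      ∀ i ∈ Finset.range (M + 1), ∀ j ∈ Finset.range (M + 1), ¬ G.Adj (p a b i) (p c d j) := by
    simp only [Filter.eventually_all_finset]
    exact fun i _ j _ => eventually_not_adj hK hU (f := fun a b => p a b i)
      (g := fun a b => p a b j) (fun a b hab => (hp a b hab).2.2.1 i)
      (fun a b hab => (hp a b hab).2.2.1 j)
  obtain ⟨y, hy, hyQ⟩ := exists_finset_of_eventually hU hQ (M + 2)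
  obtain ⟨x, hx⟩ : ∃ x : ℕ → ℕ, ∀ i : Fin (M + 2), x i = y i :=
    ⟨fun i => if h : i < M + 2 then y ⟨i, h⟩ else 0, fun i => by simp⟩
  have hxy : ∀ i (h : i < M + 2), x i = y ⟨i, h⟩ := fun i h => hx ⟨i, h⟩
  have hlt : ∀ i j, i < j → j < M + 2 → x i < x j := by
    intro i j hij hj
    rw [hxy i (by omega), hxy j hj]
    exact hy (Fin.mk_lt_mk.2 hij)
  have hfar : ∀ i j k l, i + 1 < j → j < M + 1 → k ≤ M → l ≤ M →
      ¬ G.Adj (p (x i) (x (i + 1)) k) (p (x j) (x (j + 1)) l) := by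
    intro i j k l hij hj hk hl
    rw [hxy i (by omega), hxy (i + 1) (by omega), hxy j (by omega), hxy (j + 1) (by omega)]
    exact hyQ _ _ _ _ (Fin.mk_lt_mk.2 (by omega)) (Fin.mk_lt_mk.2 (by omega))
      (Fin.mk_lt_mk.2 (by omega)) k (Finset.mem_range.2 (by omega)) l
      (Finset.mem_range.2 (by omega))
  let W : Set ℕ := {v | ∃ i ≤ M, ∃ k ≤ M, v = p (x i) (x (i + 1)) k}
  have hxW : ∀ i ≤ M + 1, x i ∈ W := by
    intro i hi
    rcases Nat.lt_or_ge i (M + 1) with h | h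
    · exact ⟨i, by omega, 0, by omega, ((hp _ _ (hlt i (i + 1) (by omega) (by omega))).1).symm⟩
    · obtain rfl : i = M + 1 := by omega
      exact ⟨M, le_rfl, M, le_rfl, ((hp _ _ (hlt M (M + 1) (by omega) (by omega))).2.1).symm⟩
  have hreach : ∀ i (hi : i ≤ M + 1),
      (G.induce W).Reachable ⟨x 0, hxW 0 (by omega)⟩ ⟨x i, hxW i hi⟩ := by
    intro i
    induction i with
    | zero => exact fun _ => SimpleGraph.Reachable.refl _
    | succ i ih =>
      intro hi
      refine (ih (by omega)).trans ?_
      obtain ⟨h₀, h₁, -, h₂⟩ := hp _ _ (hlt i (i + 1) (by omega) (by omega))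
      have := reachable_induce_of_chain (G := G) (s := W) (f := p (x i) (x (i + 1))) (n := M)
        (fun k hk => ⟨i, by omega, k, hk, rfl⟩) (fun k _ => h₂ k)
      simpa only [h₀, h₁] using this
  have hblock : ∀ v : W, ∃ i ≤ M, ∃ k ≤ M, (v : ℕ) = p (x i) (x (i + 1)) k := fun v => v.2
  choose f hfM k hkM hfk using hblock
  have hf : ∀ u v, (G.induce W).Adj u v → f v ≤ f u + 1 := by
    intro u v huv
    by_contra! hlt'
    have huv' : G.Adj u v := huv
    rw [hfk u, hfk v] at huv'
    exact hfar _ _ _ _ hlt' (by have := hfM v; omega) (hkM u) (hkM v) huv'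
  have hstart : f ⟨x 0, hxW 0 (by omega)⟩ = 0 := by
    set v : W := ⟨x 0, hxW 0 (by omega)⟩ with hv
    by_contra hne
    have hM' := hfM v
    have h₁ := ((hp _ _ (hlt (f v) (f v + 1) (by omega) (by omega))).2.2.1 (k v)).1
    rw [← hfk v] at h₁
    exact absurd (hlt 0 (f v) (by omega) (by omega)) (not_lt.2 h₁)
  have hend : M ≤ f ⟨x (M + 1), hxW _ le_rfl⟩ := by
    set v : W := ⟨x (M + 1), hxW _ le_rfl⟩ with hv
    by_contra! hne
    have h₁ := ((hp _ _ (hlt (f v) (f v + 1) (by omega) (by omega))).2.2.1 (k v)).2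
    rw [← hfk v] at h₁
    exact absurd (hlt (f v + 1) (M + 1) (by omega) (by omega)) (not_lt.2 h₁)
  have hr := hreach (M + 1) le_rfl
  obtain ⟨w, hw⟩ := hr.exists_walk_length_eq_dist
  have hlen := le_add_length_of_adj_le hf w
  refine hM _ ?_ (hasInducedPathOn_dist_add_one hr).of_induce
  omega

theorem ktt_free_unavoidable_induced_path (t : ℕ) (ht : 1 ≤ t) (M : ℕ) :
    ∃ N : ℕ, ∀ (V : Type) [Fintype V] (G : SimpleGraph V),
      ¬ ContainsKtt G t → (∃ n : ℕ, N ≤ n ∧ HasPathOn G n) →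
      ∃ m : ℕ, M ≤ m ∧ HasInducedPathOn G m := by
  by_contra! hcon
  choose V hV G hK hP hM using hcon
  choose n hn p hinj hadj using hP
  have hlarge : ∀ i, ∀ᶠ N in (Filter.hyperfilter ℕ : Filter ℕ), i < n N := fun i =>
    Nat.hyperfilter_le_atTop
      ((Filter.eventually_gt_atTop i).mono fun N hN => hN.trans_le (hn N))
  let H : SimpleGraph ℕ :=
    { Adj := fun i j => ∀ᶠ N in (Filter.hyperfilter ℕ : Filter ℕ),
        ∃ (hi : i < n N) (hj : j < n N), (G N).Adj (p N ⟨i, hi⟩) (p N ⟨j, hj⟩)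
      symm := ⟨fun i j h => h.mono fun N ⟨hi, hj, h⟩ => ⟨hj, hi, h.symm⟩⟩
      loopless := ⟨fun i h => by
        obtain ⟨N, hi, hj, h⟩ := h.exists
        exact h.ne rfl⟩ }
  have hHK : ¬ ContainsKtt H t := by
    rintro ⟨a, b, ha, hb, -, hab⟩
    have e : ∀ᶠ N in (Filter.hyperfilter ℕ : Filter ℕ), ∀ i j,
        ∃ (hi : a i < n N) (hj : b j < n N), (G N).Adj (p N ⟨a i, hi⟩) (p N ⟨b j, hj⟩) := by
      simpa only [Filter.eventually_all] using hab
    obtain ⟨N, hN⟩ := e.exists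
    have han : ∀ i, a i < n N := fun i => (hN i ⟨0, ht⟩).1
    have hbn : ∀ j, b j < n N := fun j => (hN ⟨0, ht⟩ j).2.1
    have hA : ∀ i j, (G N).Adj (p N ⟨a i, han i⟩) (p N ⟨b j, hbn j⟩) := fun i j => (hN i j).2.2
    refine hK N ⟨fun i => p N ⟨a i, han i⟩, fun j => p N ⟨b j, hbn j⟩, fun i j h => ?_,
      fun i j h => ?_, fun i j => (hA i j).ne, hA⟩
    · exact ha (Fin.mk.inj (hinj N h))
    · exact hb (Fin.mk.inj (hinj N h))
  have hHadj : ∀ i, H.Adj i (i + 1) := fun i =>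
    (hlarge (i + 1)).mono fun N hN => ⟨Nat.lt_of_succ_lt hN, hN, hadj N i hN⟩
  obtain ⟨m, hm, q, hq, hqadj⟩ := exists_hasInducedPathOn_of_adj_succ hHK hHadj M
  have e : ∀ᶠ N in (Filter.hyperfilter ℕ : Filter ℕ), ∀ i j,
      ((∃ (hi : q i < n N) (hj : q j < n N), (G N).Adj (p N ⟨q i, hi⟩) (p N ⟨q j, hj⟩)) ↔
        H.Adj (q i) (q j)) := by
    simp only [Filter.eventually_all]
    intro i j
    by_cases h : H.Adj (q i) (q j)
    · simp only [h, iff_true]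
      exact h
    · simp only [h, iff_false, Ultrafilter.eventually_not]
      exact h
  obtain ⟨N, hN, hlt⟩ :=
    (e.and (Filter.eventually_all.2 fun i => hlarge (q i))).exists
  refine hM N m hm ⟨fun i => p N ⟨q i, hlt i⟩, fun i j h => hq (Fin.mk.inj (hinj N h)),
    fun i j => ?_⟩
  rw [← hqadj, ← hN]
  exact ⟨fun h => ⟨hlt i, hlt j, h⟩, fun ⟨_, _, h⟩ => h⟩
end
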